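/- arXiv:1403.3736 — 3 statements merged into one kernel-verified Lean document; each statement's English description precedes it below -/
import Mathlib

section
/- Suppose F : W → ℝ is a Gâteaux smooth class function, continuous in the cut norm, such that: (a) for every {0,1}-valued graphon f, the Taylor polynomials P_n(f) = Σ_{m=0}^n (1/m!)·d^mF(0;f,…,f) converge to F(f) as n → ∞; and (b) the Taylor series P(F)(−) = Σ_{m≥0} Σ_{H∈ℋ_m} a_H·t(H,−) (with coefficients a_H determined by (1/m!)d^mF(0;f,…,f) = Σ_{H∈ℋ_m} a_H t(H,f) on step graphons) is absolutely convergent on W, meaning Σ_{m≥0} Σ_{H∈ℋ_m} |a_H|·t(H,1) < ∞. Then a_H = 0 for every multigraph H that is not simple, and F(f) = Σ_{m≥0} Σ_{H simple, |E(H)|=m} a_H·t(H,f) for all f ∈ W. -/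
open MeasureTheory Filter Set Topology
open scoped BigOperators Classical ENNReal

noncomputable section

/-- The type of kernels: functions `[0,1]² → ℝ` (formalized as functions on all of `ℝ²`). -/
abbrev Kern : Type := ℝ → ℝ → ℝ

/-- Lebesgue measure restricted to `[0,1]`. -/
abbrev μ01 : Measure ℝ := volume.restrict (Set.Icc 0 1)

/-- Symmetric measurable function. -/
def IsSymmMeas (f : Kern) : Prop :=
  Measurable (Function.uncurry f) ∧ ∀ x y, f x y = f y x

/-- Membership in the space `𝒲` of bounded symmetric measurable functions. -/
def IsKernel (f : Kern) : Prop := IsSymmMeas f ∧ ∃ C : ℝ, ∀ x y, |f x y| ≤ C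

/-- A graphon: a symmetric measurable function with values in `[0,1]`. -/
def IsGraphon (f : Kern) : Prop := IsSymmMeas f ∧ ∀ x y, f x y ∈ Set.Icc (0:ℝ) 1

/-- The set `W` of graphons. -/
def Graphons : Set Kern := {f | IsGraphon f}

/-- A multigraph (no loops, multiple edges allowed), with vertex set `Fin nv` and
edge (multi)set indexed by `Fin ne`, the edge `e` having endpoints `s e`, `t e`. -/
structure MG where
  nv : ℕ
  ne : ℕ
  s : Fin ne → Fin nv
  t : Fin ne → Fin nv
  noLoop : ∀ e, s e ≠ t e

/-- The homomorphism density `t(G, f)` of a multigraph `G` in a kernel `f`. -/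
def homDensity (G : MG) (f : Kern) : ℝ :=
  ∫ x : Fin G.nv → ℝ, ∏ e : Fin G.ne, f (x (G.s e)) (x (G.t e))
    ∂(Measure.pi fun _ => μ01)

/-- A node-and-edge homomorphism of multigraphs. -/
structure MGHom (G H : MG) where
  vMap : Fin G.nv → Fin H.nv
  eMap : Fin G.ne → Fin H.ne
  compat : ∀ e, ({H.s (eMap e), H.t (eMap e)} : Finset (Fin H.nv))
      = {vMap (G.s e), vMap (G.t e)}

/-- A surjective node-and-edge homomorphism. -/
def MGHom.Surj {G H : MG} (φ : MGHom G H) : Prop :=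
  Function.Surjective φ.vMap ∧ Function.Surjective φ.eMap

/-- A bijective node-and-edge homomorphism. -/
def MGHom.Bij {G H : MG} (φ : MGHom G H) : Prop :=
  Function.Bijective φ.vMap ∧ Function.Bijective φ.eMap

instance (G H : MG) : Finite (MGHom G H) := by
  have hinj : Function.Injective (fun φ : MGHom G H => (φ.vMap, φ.eMap)) := by
    rintro ⟨v1, e1, h1⟩ ⟨v2, e2, h2⟩ h
    simp only [Prod.mk.injEq] at h
    obtain ⟨hv, he⟩ := h
    subst hv; subst he; rfl
  exact Finite.of_injective _ hinj

/-- Isomorphism of multigraphs. -/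
def MGIso (G H : MG) : Prop := ∃ φ : MGHom G H, φ.Bij

/-- A multigraph with no isolated vertices. -/
def NoIsolated (G : MG) : Prop := ∀ v, ∃ e, G.s e = v ∨ G.t e = v

/-- A multigraph is simple if no two (distinct) edges have the same pair of endpoints. -/
def IsSimpleMG (G : MG) : Prop :=
  ∀ e e', ({G.s e, G.t e} : Finset (Fin G.nv)) = ({G.s e', G.t e'} : Finset (Fin G.nv))
    → e = e'

/-- A class function on graphon space: it only depends on the homomorphism densities
with respect to finite simple graphs. -/
def IsClassFun (F : Kern → ℝ) : Prop :=
  ∀ f g, IsGraphon f → IsGraphon g →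
    (∀ G : MG, IsSimpleMG G → homDensity G f = homDensity G g) → F f = F g

/-- The `L¹` distance between two kernels (on the square `[0,1]²`). -/
def l1Dist (f g : Kern) : ℝ := ∫ x, ∫ y, |f x y - g x y| ∂μ01 ∂μ01

/-- Continuity on the set of graphons with respect to the `L¹` norm. -/
def L1ContOn (F : Kern → ℝ) : Prop :=
  ∀ f ∈ Graphons, ∀ ε : ℝ, 0 < ε → ∃ δ : ℝ, 0 < δ ∧
    ∀ g ∈ Graphons, l1Dist f g < δ → |F f - F g| < ε

/-- The cut norm of a kernel. -/
def cutNorm (f : Kern) : ℝ :=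
  sSup {r : ℝ | ∃ S T : Set ℝ, MeasurableSet S ∧ MeasurableSet T ∧
    S ⊆ Set.Icc 0 1 ∧ T ⊆ Set.Icc 0 1 ∧ r = |∫ x in S, ∫ y in T, f x y|}

/-- Continuity on the set of graphons with respect to the cut norm. -/
def CutContOn (F : Kern → ℝ) : Prop :=
  ∀ f ∈ Graphons, ∀ ε : ℝ, 0 < ε → ∃ δ : ℝ, 0 < δ ∧
    ∀ g ∈ Graphons, cutNorm (f - g) < δ → |F f - F g| < ε

section Gateaux

variable {E : Type*} [AddCommGroup E] [Module ℝ E]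

/-- Admissible directions at `f` for a convex subset `U` of a real vector space:
directions `g` so that `f + ε g ∈ U` for all sufficiently small `ε ∈ [0,1)`. -/
def adm (U : Set E) (f : E) : Set E :=
  {g | ∃ ε₀ : ℝ, 0 < ε₀ ∧ ε₀ ≤ 1 ∧ ∀ ε : ℝ, 0 ≤ ε → ε < ε₀ → f + ε • g ∈ U}

/-- Iterated mixed Gâteaux derivative `d^n F(f; g₁, …, g_n)` of `F : U → ℝ`, computed
through one-sided difference quotients restricted to `U`; the derivative in the last
direction is taken first.  (The value is given by `Filter.limUnder`, i.e. it is the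
limit of the difference quotients whenever this limit exists.) -/
def gD (U : Set E) (F : E → ℝ) : (n : ℕ) → E → (Fin n → E) → ℝ
  | 0 => fun f _ => F f
  | n + 1 => fun f g =>
      limUnder (nhdsWithin (0:ℝ) {t : ℝ | t ≠ 0 ∧ f + t • g (Fin.last n) ∈ U})
        (fun t => (gD U F n (f + t • g (Fin.last n)) (fun i => g i.castSucc)
              - gD U F n f (fun i => g i.castSucc)) / t)

/-- `F` is `n` times Gâteaux differentiable on `U`: all iterated Gâteaux derivatives
up to order `n` in admissible directions exist (i.e. the corresponding difference
quotients genuinely converge). -/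
def GDiffN (U : Set E) (F : E → ℝ) : ℕ → Prop
  | 0 => True
  | n + 1 => GDiffN U F n ∧
      ∀ f ∈ U, ∀ g : Fin (n+1) → E, (∀ i, g i ∈ adm U f) →
        Tendsto
          (fun t : ℝ => (gD U F n (f + t • g (Fin.last n)) (fun i => g i.castSucc)
              - gD U F n f (fun i => g i.castSucc)) / t)
          (nhdsWithin (0:ℝ) {t : ℝ | t ≠ 0 ∧ f + t • g (Fin.last n) ∈ U})
          (nhds (gD U F (n+1) f g))

/-- `F : U → ℝ` is `C^n` at `f`: for any admissible directions `g₁, …, g_m`, the map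
`(λ₁, …, λ_m) ↦ F(f + Σᵢ λᵢ gᵢ)` admits a `C^n` extension to all of `ℝ^m`. -/
def IsCnAt (U : Set E) (F : E → ℝ) (n : ℕ) (f : E) : Prop :=
  ∀ (m : ℕ) (g : Fin m → E), (∀ i, g i ∈ adm U f) →
    ∃ G : (Fin m → ℝ) → ℝ, ContDiff ℝ n G ∧
      ∀ lam : Fin m → ℝ, f + ∑ i, lam i • g i ∈ U → G lam = F (f + ∑ i, lam i • g i)

/-- `F` is `C^n` (everywhere on `U`). -/
def IsCn (U : Set E) (F : E → ℝ) (n : ℕ) : Prop := ∀ f ∈ U, IsCnAt U F n f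

/-- `F` is Gâteaux smooth: `C^n` at every point for every `n`. -/
def GSmooth (U : Set E) (F : E → ℝ) : Prop := ∀ n : ℕ, IsCn U F n

end Gateaux

/-- Iso-invariance of a family of constants indexed by multigraphs. -/
def IsoInvariant (a : MG → ℝ) : Prop := ∀ G H, MGIso G H → a G = a H

/-- Coefficients indexed by the isomorphism classes of multigraphs with at most `N`
edges and no isolated vertices (encoded as iso-invariant families of constants
vanishing outside this class of multigraphs). -/
def GoodCoeffs (N : ℕ) (a : MG → ℝ) : Prop :=
  IsoInvariant a ∧ ∀ G : MG, ¬(G.ne ≤ N ∧ NoIsolated G) → a G = 0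

/-- A functional on `W^n` is multilinear if its restriction to tuples from the
subspace `𝒲` (= span of `W`) is linear in each coordinate. -/
def MultilinearOnKerns (n : ℕ) (Λ : (Fin n → Kern) → ℝ) : Prop :=
  (∀ (g : Fin n → Kern), (∀ j, IsKernel (g j)) → ∀ (i : Fin n) (u v : Kern),
      IsKernel u → IsKernel v →
      Λ (Function.update g i (u + v))
        = Λ (Function.update g i u) + Λ (Function.update g i v)) ∧
  (∀ (g : Fin n → Kern), (∀ j, IsKernel (g j)) → ∀ (i : Fin n) (c : ℝ) (u : Kern),
      IsKernel u →
      Λ (Function.update g i (c • u)) = c * Λ (Function.update g i u))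

/-- A functional on `W^n` extends to a multilinear functional on `(span ℝ W)^n`. -/
def IsMultilinearOnW (n : ℕ) (Λ : (Fin n → Kern) → ℝ) : Prop :=
  ∃ L : MultilinearMap ℝ (fun _ : Fin n => ↥(Submodule.span ℝ Graphons)) ℝ,
    ∀ (g : Fin n → Kern) (h : ∀ i, g i ∈ Graphons),
      L (fun i => ⟨g i, Submodule.subset_span (h i)⟩) = Λ g

/-- An invertible Lebesgue-measure-preserving bijection of `[0,1]`. -/
def IsMPB (σ : ℝ → ℝ) : Prop :=
  MeasurePreserving σ μ01 μ01 ∧ Set.BijOn σ (Set.Icc 0 1) (Set.Icc 0 1)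

/-- The action `f ↦ f^σ` of maps of `[0,1]` on kernels. -/
def Kern.translate (σ : ℝ → ℝ) (f : Kern) : Kern := fun x y => f (σ x) (σ y)

/-- The cell `((a)/p, (a+1)/p]` of the regular partition of `[0,1]` (`a = 0, …, p-1`). -/
def cell (p : ℕ) (a : Fin p) : Set ℝ :=
  Set.Ioc (((a : ℕ) : ℝ) / (p : ℝ)) ((((a : ℕ) : ℝ) + 1) / (p : ℝ))

/-- The basic step graphon `e^p_(a,b)`: symmetrized indicator of `cell a × cell b`. -/
def ep (p : ℕ) (a b : Fin p) : Kern := fun x y =>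
  if (x ∈ cell p a ∧ y ∈ cell p b) ∨ (x ∈ cell p b ∧ y ∈ cell p a) then 1 else 0

/-- The step kernel with values `c a b` on the cell `cell a × cell b` (`a ≠ b`) and `0`
on the diagonal cells and outside `(0,1]²`. -/
def stepFn (p : ℕ) (c : Fin p → Fin p → ℝ) : Kern := fun x y =>
  ∑ a : Fin p, ∑ b : Fin p, if a ≠ b ∧ x ∈ cell p a ∧ y ∈ cell p b then c a b else 0

/-- The set `W_𝐩 = ⋃ₚ W_p` of step graphons. -/
def StepGraphons : Set Kern := {f | IsGraphon f ∧ ∃ p c, f = stepFn p c}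

/-- The union of the `S_[0,1]`-translates of `W_𝐩`. -/
def StepTranslates : Set Kern :=
  {f | ∃ σ : ℝ → ℝ, IsMPB σ ∧ ∃ g ∈ StepGraphons, f = Kern.translate σ g}

/-- Add `m` isolated vertices to a multigraph. -/
def MG.pad (G : MG) (m : ℕ) : MG where
  nv := G.nv + m
  ne := G.ne
  s := fun e => Fin.castAdd m (G.s e)
  t := fun e => Fin.castAdd m (G.t e)
  noLoop := fun e h => G.noLoop e (by
    apply Fin.ext
    simpa using congrArg Fin.val h)

/-- Two multigraphs become isomorphic after deleting isolated vertices (equivalently,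
after adding enough isolated vertices). -/
def StripEquiv (G H : MG) : Prop := ∃ a b : ℕ, MGIso (G.pad a) (H.pad b)

/-- A tuple of pairs of distinct indices in `Fin p` (encoding a tuple in `E_p^n`). -/
def ValidTuple (p n : ℕ) (x : Fin n → Fin p × Fin p) : Prop := ∀ l, (x l).1 ≠ (x l).2

/-- The multigraph `Γ_{n,p}(x)` associated to a tuple `x ∈ E_p^n`. -/
def tupleMG (p n : ℕ) (x : Fin n → Fin p × Fin p) (hx : ValidTuple p n x) : MG :=
  ⟨p, n, fun l => (x l).1, fun l => (x l).2, hx⟩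

/-- Symmetry of a functional on `W^n` under permutation of arguments. -/
def SymmFunc (n : ℕ) (Λ : (Fin n → Kern) → ℝ) : Prop :=
  ∀ (g : Fin n → Kern), (∀ i, g i ∈ Graphons) → ∀ τ : Equiv.Perm (Fin n),
    Λ (g ∘ τ) = Λ g

/-- `S_[0,1]`-invariance of a functional on `W^n`. -/
def SInvFunc (n : ℕ) (Λ : (Fin n → Kern) → ℝ) : Prop :=
  ∀ (g : Fin n → Kern), (∀ i, g i ∈ Graphons) → ∀ σ : ℝ → ℝ, IsMPB σ →
    Λ (fun i => Kern.translate σ (g i)) = Λ g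

/-- `π` is the consistency-constraint matrix `π_{n,k}`: it is invariant under
isomorphism-after-deleting-isolated-vertices in both arguments, and for every `p ≥ 2`,
every symmetric `S_[0,1]`-invariant multilinear functional `Λ : W^n → ℝ`, every
`x ∈ E_p^n` and every complete system `y` of pairwise non-isomorphic representatives
of the multigraphs with `n` edges on `kp` vertices, one has
`C_{n,p}(Λ)(Γ(x)) = Σ_h π(Γ(x)∼, h∼) C_{n,kp}(Λ)(h)`. -/
def ConsistencyMatrix (n k : ℕ) (π : MG → MG → ℕ) : Prop :=
  (∀ G G' H H', StripEquiv G G' → StripEquiv H H' → π G H = π G' H') ∧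
  ∀ p : ℕ, 2 ≤ p → ∀ Λ : (Fin n → Kern) → ℝ,
    SymmFunc n Λ → SInvFunc n Λ → MultilinearOnKerns n Λ →
    ∀ (x : Fin n → Fin p × Fin p) (hx : ValidTuple p n x),
    ∀ (m : ℕ) (y : Fin m → Fin n → Fin (k*p) × Fin (k*p))
      (hy : ∀ i, ValidTuple (k*p) n (y i)),
      (∀ i j, i ≠ j →
        ¬ MGIso (tupleMG (k*p) n (y i) (hy i)) (tupleMG (k*p) n (y j) (hy j))) →
      (∀ (z : Fin n → Fin (k*p) × Fin (k*p)) (hz : ValidTuple (k*p) n z),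
        ∃ i, MGIso (tupleMG (k*p) n z hz) (tupleMG (k*p) n (y i) (hy i))) →
      Λ (fun l => ep p (x l).1 (x l).2)
        = ∑ i : Fin m,
            (π (tupleMG p n x hx) (tupleMG (k*p) n (y i) (hy i)) : ℝ)
              * Λ (fun l => ep (k*p) (y i l).1 (y i l).2)

/-- Adjacency relation of a multigraph. -/
def MG.adj (G : MG) (u v : Fin G.nv) : Prop :=
  ∃ e, (G.s e = u ∧ G.t e = v) ∨ (G.s e = v ∧ G.t e = u)

/-- The homomorphism density of the simplification `G^simp` of a multigraph `G`
(replace each family of parallel edges by a single edge). -/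
def simpHomDensity (G : MG) (f : Kern) : ℝ :=
  ∫ x : Fin G.nv → ℝ,
    ∏ q ∈ Finset.univ.filter (fun q : Fin G.nv × Fin G.nv => q.1 < q.2 ∧ G.adj q.1 q.2),
      f (x q.1) (x q.2) ∂(Measure.pi fun _ => μ01)

/-- Tensor product of two kernels with respect to a fixed measure-preserving map
`φ : [0,1] → [0,1]²`. -/
def tensProd (φ : ℝ → ℝ × ℝ) (f g : Kern) : Kern :=
  fun x y => f (φ x).1 (φ y).1 * g (φ x).2 (φ y).2

/-- `m`-fold tensor power of a kernel. -/
def tensPow (φ : ℝ → ℝ × ℝ) (f : Kern) : ℕ → Kern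
  | 0 => fun _ _ => 1
  | 1 => f
  | (m+2) => tensProd φ f (tensPow φ f (m+1))

/-- A complete system of representatives for the isomorphism classes of multigraphs
with no isolated vertices. -/
def IsRepSet (R : Set MG) : Prop :=
  (∀ G ∈ R, NoIsolated G) ∧ ∀ G : MG, NoIsolated G → ∃! H, H ∈ R ∧ MGIso G H

/-- A `k`-labelled multigraph: a multigraph together with an injective labelling of `k`
distinguished vertices. -/
structure LMG (k : ℕ) where
  G : MG
  lab : Fin k → Fin G.nv
  inj : Function.Injective lab

/-- No unlabelled isolated vertices. -/
def LMG.NoUnlabIsolated {k : ℕ} (H : LMG k) : Prop :=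
  ∀ v, (∃ e, H.G.s e = v ∨ H.G.t e = v) ∨ ∃ a, H.lab a = v

/-- Assignment of coordinates to the vertices of a `k`-labelled multigraph: labelled
vertices get the fixed values `x`, unlabelled ones the integration variables `y`. -/
def LMG.assign {k : ℕ} (H : LMG k) (x : Fin k → ℝ) (y : Fin H.G.nv → ℝ) :
    Fin H.G.nv → ℝ :=
  fun v => if h : ∃ a, H.lab a = v then x h.choose else y v

/-- The partially labelled homomorphism density `t_𝐱(H, f)`. -/
def lhom {k : ℕ} (H : LMG k) (x : Fin k → ℝ) (f : Kern) : ℝ :=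
  ∫ y : Fin H.G.nv → ℝ,
    ∏ e : Fin H.G.ne, f (H.assign x y (H.G.s e)) (H.assign x y (H.G.t e))
    ∂(Measure.pi fun _ => μ01)

/-- The weighted partially labelled homomorphism density `t_𝐱(H, f; w)`. -/
def wlhom {k : ℕ} (H : LMG k) (x : Fin k → ℝ) (f : Kern)
    (w : (Fin H.G.nv → ℝ) → ℝ) : ℝ :=
  ∫ y : Fin H.G.nv → ℝ,
    w (H.assign x y) *
      ∏ e : Fin H.G.ne, f (H.assign x y (H.G.s e)) (H.assign x y (H.G.t e))
    ∂(Measure.pi fun _ => μ01)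

/-- The seminorm `‖w‖_{1,𝐱} = t_𝐱(H, 1, |w|)` of a weight. -/
def wnorm {k : ℕ} (H : LMG k) (x : Fin k → ℝ) (w : (Fin H.G.nv → ℝ) → ℝ) : ℝ :=
  ∫ y : Fin H.G.nv → ℝ, |w (H.assign x y)| ∂(Measure.pi fun _ => μ01)

/-- Label-respecting isomorphism of `k`-labelled multigraphs. -/
def LMGIso {k : ℕ} (H H' : LMG k) : Prop :=
  ∃ (φv : Fin H.G.nv ≃ Fin H'.G.nv) (φe : Fin H.G.ne ≃ Fin H'.G.ne),
    (∀ e, ({H'.G.s (φe e), H'.G.t (φe e)} : Finset (Fin H'.G.nv))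
        = {φv (H.G.s e), φv (H.G.t e)}) ∧
    ∀ a, φv (H.lab a) = H'.lab a

/-- A complete system of representatives for the label-respecting isomorphism classes
of `k`-labelled multigraphs with no unlabelled isolated vertices. -/
def IsLRepSet (k : ℕ) (R : Set (LMG k)) : Prop :=
  (∀ H ∈ R, H.NoUnlabIsolated) ∧
  ∀ H : LMG k, H.NoUnlabIsolated → ∃! H', H' ∈ R ∧ LMGIso H H'

end

instance prob_mu01 : IsProbabilityMeasure μ01 := ⟨by simp⟩

lemma meas_comp {ι : Type*} (f : Kern) (hf : Measurable (Function.uncurry f)) (i j : ι) :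
    Measurable (fun x : ι → ℝ => f (x i) (x j)) := by
  have : Measurable (fun x : ι → ℝ => (x i, x j)) := by fun_prop
  exact hf.comp this

lemma homDensity_one (G : MG) : homDensity G (fun _ _ => 1) = 1 := by
  simp [homDensity]

lemma homDensity_smul (G : MG) (c : ℝ) (f : Kern) :
    homDensity G (c • f) = c ^ G.ne * homDensity G f := by
  simp [homDensity, Finset.prod_mul_distrib, integral_const_mul]

lemma abs_homDensity_le (G : MG) (f : Kern) (hf : IsGraphon f) : |homDensity G f| ≤ 1 := by
  have h := norm_integral_le_of_norm_le_const (μ := Measure.pi fun _ : Fin G.nv => μ01)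
    (f := fun x => ∏ e : Fin G.ne, f (x (G.s e)) (x (G.t e))) (C := 1)
    (Eventually.of_forall fun x => by
      rw [norm_prod]
      apply Finset.prod_le_one
      · intros; positivity
      · intro e _
        have := hf.2 (x (G.s e)) (x (G.t e))
        rw [Real.norm_eq_abs, abs_le]
        constructor <;> linarith [this.1, this.2])
  simpa [homDensity] using h

lemma symm_eq_of_pair {α : Type*} (f : α → α → ℝ) (hf : ∀ x y, f x y = f y x)
    {n : ℕ} (x : Fin n → α) {a b c d : Fin n} (h : s(a, b) = s(c, d)) :
    f (x a) (x b) = f (x c) (x d) := by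
  rw [Sym2.eq_iff] at h
  rcases h with ⟨rfl, rfl⟩ | ⟨rfl, rfl⟩
  · rfl
  · exact hf _ _

lemma finset_pair_iff {n : ℕ} {a b c d : Fin n} :
    ({a, b} : Finset (Fin n)) = {c, d} ↔ s(a, b) = s(c, d) := by
  rw [Sym2.eq_iff, ← Finset.coe_inj]
  simpa using Set.pair_eq_pair_iff

lemma homDensity_iso {G H : MG} (h : MGIso G H) (f : Kern) (hf : ∀ x y, f x y = f y x) :
    homDensity G f = homDensity H f := by
  obtain ⟨φ, hv, he⟩ := h
  let ev := Equiv.ofBijective _ hv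
  let ee := Equiv.ofBijective _ he
  have mp := measurePreserving_piCongrLeft (fun _ : Fin H.nv => μ01) ev
  unfold homDensity
  rw [← mp.integral_comp' (g := fun x => ∏ e : Fin H.ne, f (x (H.s e)) (x (H.t e)))]
  congr 1
  ext x
  rw [← ee.prod_comp]
  refine Finset.prod_congr rfl fun e _ => ?_
  have h1 := φ.compat e
  rw [finset_pair_iff] at h1
  have h2 : ∀ v, (MeasurableEquiv.piCongrLeft (fun _ => ℝ) ev) x (φ.vMap v) = x v := fun v =>
    Equiv.piCongrLeft_apply_apply (fun _ => ℝ) ev x v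
  have := symm_eq_of_pair f hf ((MeasurableEquiv.piCongrLeft (fun _ => ℝ) ev) x) h1
  rw [h2, h2] at this
  exact this.symm

/-- The edge set of the simplification. -/
noncomputable def simpEdges (G : MG) : Finset (Fin G.nv × Fin G.nv) :=
  Finset.univ.filter (fun q => q.1 < q.2 ∧ ∃ e, s(G.s e, G.t e) = s(q.1, q.2))

/-- Simplification of a multigraph. -/
noncomputable def simpMG (G : MG) : MG where
  nv := G.nv
  ne := (simpEdges G).card
  s := fun e => ((simpEdges G).equivFin.symm e).1.1
  t := fun e => ((simpEdges G).equivFin.symm e).1.2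
  noLoop := fun e => by
    have := ((simpEdges G).equivFin.symm e).2
    simp only [simpEdges, Finset.mem_filter] at this
    exact ne_of_lt this.2.1

lemma simpEdges_exists (G : MG) (e : Fin G.ne) :
    ∃ q ∈ simpEdges G, s(G.s e, G.t e) = s(q.1, q.2) := by
  rcases lt_or_gt_of_ne (G.noLoop e) with h | h
  · exact ⟨(G.s e, G.t e), by simp [simpEdges, h]; exact ⟨e, by simp⟩, rfl⟩
  · exact ⟨(G.t e, G.s e), by simp [simpEdges, h]; exact ⟨e, by simp⟩, Sym2.eq_swap⟩

lemma simpMG_simple (G : MG) : IsSimpleMG (simpMG G) := by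
  intro e e' h
  rw [finset_pair_iff, Sym2.eq_iff] at h
  have h1 := ((simpEdges G).equivFin.symm e).2
  have h2 := ((simpEdges G).equivFin.symm e').2
  simp only [simpEdges, Finset.mem_filter] at h1 h2
  apply (simpEdges G).equivFin.symm.injective
  apply Subtype.ext
  rcases h with ⟨ha, hb⟩ | ⟨ha, hb⟩
  · exact Prod.ext ha hb
  · exfalso
    have h3 := h1.2.1
    have h4 := h2.2.1
    change (((simpEdges G).equivFin.symm e).1.1 = ((simpEdges G).equivFin.symm e').1.2) at ha
    change (((simpEdges G).equivFin.symm e).1.2 = ((simpEdges G).equivFin.symm e').1.1) at hb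
    simp only [simpEdges] at ha hb
    rw [ha, hb] at h3
    exact lt_asymm h3 h4

lemma simpMG_noIsolated (G : MG) (h : NoIsolated G) : NoIsolated (simpMG G) := by
  intro (v : Fin G.nv)
  obtain ⟨e, he⟩ := h v
  obtain ⟨q, hq, hs⟩ := simpEdges_exists G e
  refine ⟨(simpEdges G).equivFin ⟨q, hq⟩, ?_⟩
  have hv : (v : Fin G.nv) ∈ s(q.1, q.2) := by
    rw [← hs, Sym2.mem_iff]
    rcases he with h | h
    · exact Or.inl h.symm
    · exact Or.inr h.symm
  rw [Sym2.mem_iff] at hv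
  simp only [simpMG, Equiv.symm_apply_apply]
  rcases hv with h | h
  · exact Or.inl h.symm
  · exact Or.inr h.symm

lemma homDensity_simpMG (G : MG) (f : Kern) (hf : ∀ x y, f x y = f y x)
    (h01 : ∀ x y, f x y = 0 ∨ f x y = 1) : homDensity (simpMG G) f = homDensity G f := by
  unfold homDensity
  change ∫ x : Fin G.nv → ℝ, _ ∂_ = _
  congr 1
  ext x
  by_cases hall : ∀ e : Fin G.ne, f (x (G.s e)) (x (G.t e)) = 1
  · rw [Finset.prod_eq_one fun e _ => hall e]
    refine Finset.prod_eq_one fun e _ => ?_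
    have h1 := ((simpEdges G).equivFin.symm e).2
    simp only [simpEdges, Finset.mem_filter] at h1
    obtain ⟨e', he'⟩ := h1.2.2
    rw [← hall e']
    exact symm_eq_of_pair f hf x he'.symm
  · push Not at hall
    obtain ⟨e, he⟩ := hall
    have he0 := (h01 _ _).resolve_right he
    rw [Finset.prod_eq_zero (Finset.mem_univ e) he0]
    obtain ⟨q, hq, hs⟩ := simpEdges_exists G e
    refine Finset.prod_eq_zero (Finset.mem_univ ((simpEdges G).equivFin ⟨q, hq⟩)) ?_
    rw [← he0]
    simp only [simpMG, Equiv.symm_apply_apply]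
    exact symm_eq_of_pair f hf x hs.symm

/-- Bound on the bilinear form defined by a kernel. -/
def CutB (h : Kern) (ε : ℝ) : Prop :=
  ∀ u v : ℝ → ℝ, Measurable u → Measurable v → (∀ x, |u x| ≤ 1) → (∀ x, |v x| ≤ 1) →
    |∫ x, ∫ y, h x y * (u x * v y) ∂μ01 ∂μ01| ≤ ε

lemma mp_update {n : ℕ} (u : Fin n) :
    MeasurePreserving (fun z : (Fin n → ℝ) × ℝ => Function.update z.1 u z.2)
      ((Measure.pi fun _ : Fin n => μ01).prod μ01) (Measure.pi fun _ : Fin n => μ01) := by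
  have hm : Measurable (fun z : (Fin n → ℝ) × ℝ => Function.update z.1 u z.2) := by
    rw [measurable_pi_iff]
    intro i
    by_cases h : i = u
    · subst h; simpa using measurable_snd
    · simp only [Function.update_of_ne h]; fun_prop
  refine ⟨hm, (Measure.pi_eq fun s hs => ?_).symm⟩
  rw [Measure.map_apply hm (MeasurableSet.univ_pi hs)]
  have : (fun z : (Fin n → ℝ) × ℝ => Function.update z.1 u z.2) ⁻¹' Set.pi univ s
      = (Set.pi univ (Function.update s u univ)) ×ˢ (s u) := by
    ext ⟨z, t⟩
    simp only [mem_preimage, Set.mem_pi, mem_univ, true_imp_iff, mem_prod]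
    constructor
    · intro h
      refine ⟨fun i => ?_, by simpa using h u⟩
      by_cases hi : i = u
      · subst hi; simp
      · simpa [hi] using h i
    · rintro ⟨h1, h2⟩ i
      by_cases hi : i = u
      · subst hi; simpa using h2
      · simpa [hi] using h1 i
  rw [this, Measure.prod_prod, Measure.pi_pi]
  rw [← Finset.mul_prod_erase _ _ (Finset.mem_univ u),
    ← Finset.mul_prod_erase (a := u) (f := fun i => μ01 (s i)) _ (Finset.mem_univ u)]
  rw [Function.update_self, measure_univ, one_mul, mul_comm]
  congr 1
  refine Finset.prod_congr rfl fun i hi => ?_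
  rw [Function.update_of_ne (Finset.ne_of_mem_erase hi)]

lemma integral_two_update {n : ℕ} (u v : Fin n) (φ : (Fin n → ℝ) → ℝ) (hφ : Measurable φ)
    (C : ℝ) (hC : ∀ x, |φ x| ≤ C) :
    ∫ x, φ x ∂(Measure.pi fun _ : Fin n => μ01) =
      ∫ z, ∫ s, ∫ t, φ (Function.update (Function.update z u s) v t) ∂μ01 ∂μ01
        ∂(Measure.pi fun _ : Fin n => μ01) := by
  have m1 := mp_update u
  have m2 := mp_update v
  have i0 : Integrable φ (Measure.pi fun _ : Fin n => μ01) :=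
    Integrable.of_bound hφ.aestronglyMeasurable C (Eventually.of_forall hC)
  have i2 : Integrable (fun z : (Fin n → ℝ) × ℝ => φ (Function.update z.1 v z.2)) _ := (m2.integrable_comp hφ.aestronglyMeasurable).2 i0
  rw [← m2.map_eq, integral_map m2.measurable.aemeasurable hφ.aestronglyMeasurable,
    m2.map_eq, integral_prod _ i2]
  have i3 := i2.integral_prod_left
  have i4 := (m1.integrable_comp i3.aestronglyMeasurable).2 i3
  have key := integral_map m1.measurable.aemeasurable (by rw [m1.map_eq]; exact i3.aestronglyMeasurable)
  rw [m1.map_eq] at key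
  rw [key]
  exact integral_prod _ i4

lemma prod_bd {ι : Type*} (S : Finset ι) (w : ι → ℝ) (hw : ∀ i, |w i| ≤ 1) :
    |∏ i ∈ S, w i| ≤ 1 := by
  rw [Finset.abs_prod]
  exact Finset.prod_le_one (fun _ _ => abs_nonneg _) fun i _ => hw i

lemma graphon_abs {f : Kern} (hf : IsGraphon f) (x y : ℝ) : |f x y| ≤ 1 := by
  have := hf.2 x y
  rw [abs_le]; constructor <;> linarith [this.1, this.2]

lemma counting_one (K : MG) (hK : IsSimpleMG K) (h : Kern) (hh : Measurable (Function.uncurry h))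
    (C : ℝ) (hhC : ∀ x y, |h x y| ≤ C)
    (ε : ℝ) (hc : CutB h ε) (w : Fin K.ne → Kern) (hw : ∀ e, IsGraphon (w e)) (e : Fin K.ne) :
    |∫ x : Fin K.nv → ℝ, h (x (K.s e)) (x (K.t e)) *
      ∏ e' ∈ Finset.univ.erase e, w e' (x (K.s e')) (x (K.t e'))
        ∂(Measure.pi fun _ => μ01)| ≤ ε := by
  have hC0 : 0 ≤ C := (abs_nonneg _).trans (hhC 0 0)
  set φ : (Fin K.nv → ℝ) → ℝ := fun x => h (x (K.s e)) (x (K.t e)) *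
      ∏ e' ∈ Finset.univ.erase e, w e' (x (K.s e')) (x (K.t e')) with hφ
  have hm : Measurable φ := (meas_comp h hh _ _).mul
    (Finset.measurable_fun_prod _ fun e' _ => meas_comp _ (hw e').1.1 _ _)
  have hb : ∀ x, |φ x| ≤ C := fun x => by
    rw [hφ]; simp only [abs_mul]
    calc _ ≤ C * 1 := mul_le_mul (hhC _ _) (prod_bd _ _ fun e' => graphon_abs (hw e') _ _)
          (abs_nonneg _) hC0
      _ = C := mul_one _
  rw [integral_two_update (K.s e) (K.t e) φ hm C hb]
  have hne := K.noLoop e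
  have key : ∀ z : Fin K.nv → ℝ,
      ‖∫ s, ∫ t, φ (Function.update (Function.update z (K.s e) s) (K.t e) t) ∂μ01 ∂μ01‖ ≤ ε := by
    intro z
    let A := (Finset.univ.erase e).filter (fun e' => K.s e' = K.t e ∨ K.t e' = K.t e)
    let A' := (Finset.univ.erase e).filter (fun e' => ¬ (K.s e' = K.t e ∨ K.t e' = K.t e))
    let V : ℝ → ℝ := fun t => ∏ e' ∈ A, w e' (Function.update z (K.t e) t (K.s e'))
      (Function.update z (K.t e) t (K.t e'))
    let U : ℝ → ℝ := fun s => ∏ e' ∈ A', w e' (Function.update z (K.s e) s (K.s e'))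
      (Function.update z (K.s e) s (K.t e'))
    have hupd : ∀ v : Fin K.nv, Measurable fun s : ℝ => Function.update z v s := fun v =>
      measurable_update z
    have hU : Measurable U := Finset.measurable_fun_prod _ fun e' _ =>
      (meas_comp _ (hw e').1.1 (K.s e') (K.t e')).comp (hupd _)
    have hV : Measurable V := Finset.measurable_fun_prod _ fun e' _ =>
      (meas_comp _ (hw e').1.1 (K.s e') (K.t e')).comp (hupd _)
    have := hc U V hU hV (fun x => prod_bd _ _ fun e' => graphon_abs (hw e') _ _)
      (fun x => prod_bd _ _ fun e' => graphon_abs (hw e') _ _)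
    rw [Real.norm_eq_abs]
    convert this using 6 with s t
    simp only [hφ, Function.update_self, Function.update_of_ne hne]
    congr 1
    rw [← Finset.prod_filter_mul_prod_filter_not (Finset.univ.erase e)
      (fun e' => K.s e' = K.t e ∨ K.t e' = K.t e), mul_comm]
    congr 1
    · refine Finset.prod_congr rfl fun e' he' => ?_
      replace he' := Finset.mem_filter.1 he'
      rw [not_or] at he'
      rw [Function.update_of_ne he'.2.1, Function.update_of_ne he'.2.2]
    · refine Finset.prod_congr rfl fun e' he' => ?_
      replace he' := Finset.mem_filter.1 he'
      rw [Finset.mem_erase] at he'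
      have hn : K.s e' ≠ K.s e ∧ K.t e' ≠ K.s e := by
        by_contra hcon
        apply he'.1.1
        apply hK
        rw [finset_pair_iff, Sym2.eq_iff]
        have h1 := K.noLoop e'
        have h2 := K.noLoop e
        grind
      have h3 : ∀ v, v ≠ K.s e → Function.update (Function.update z (K.s e) s) (K.t e) t v
          = Function.update z (K.t e) t v := by
        intro v hv
        by_cases hv' : v = K.t e
        · subst hv'; simp
        · simp [hv', hv]
      rw [h3 _ hn.1, h3 _ hn.2]
  have := norm_integral_le_of_norm_le_const (μ := Measure.pi fun _ : Fin K.nv => μ01)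
    (Eventually.of_forall key)
  simpa using this

lemma graphon_sub_bd {f g : Kern} (hf : IsGraphon f) (hg : IsGraphon g) (x y : ℝ) :
    |(f - g) x y| ≤ 1 := by
  have h1 := hf.2 x y
  have h2 := hg.2 x y
  simp only [Pi.sub_apply]
  rw [abs_le]; constructor <;> linarith [h1.1, h1.2, h2.1, h2.2]

lemma graphon_sub_meas {f g : Kern} (hf : IsGraphon f) (hg : IsGraphon g) :
    Measurable (Function.uncurry (f - g)) := hf.1.1.sub hg.1.1

lemma counting (K : MG) (hK : IsSimpleMG K) (f g : Kern) (hf : IsGraphon f) (hg : IsGraphon g)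
    (ε : ℝ) (hc : CutB (f - g) ε) :
    |homDensity K f - homDensity K g| ≤ K.ne * ε := by
  let P : Finset (Fin K.ne) → (Fin K.nv → ℝ) → ℝ := fun S x =>
    ∏ e, (if e ∈ S then f else g) (x (K.s e)) (x (K.t e))
  have hw : ∀ (S : Finset (Fin K.ne)) e, IsGraphon (if e ∈ S then f else g) := by
    intro S e; split_ifs <;> assumption
  have hPi : ∀ S, Integrable (P S) (Measure.pi fun _ => μ01) := fun S =>
    Integrable.of_bound (Finset.measurable_fun_prod _ fun e' _ =>
      meas_comp _ (hw S e').1.1 _ _).aestronglyMeasurable 1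
      (Eventually.of_forall fun x => prod_bd _ _ fun e' => graphon_abs (hw S e') _ _)
  have main : ∀ S : Finset (Fin K.ne),
      |∫ x, P S x ∂(Measure.pi fun _ => μ01) - ∫ x, P ∅ x ∂(Measure.pi fun _ => μ01)|
        ≤ S.card * ε := by
    intro S
    induction S using Finset.induction_on with
    | empty => simp
    | insert e S he ih =>
      have h1 := counting_one K hK (f - g) (graphon_sub_meas hf hg) 1 (graphon_sub_bd hf hg) ε hc
        (fun e' => if e' ∈ S then f else g) (hw S) e
      have h2 : ∫ x, P (insert e S) x ∂(Measure.pi fun _ => μ01)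
          - ∫ x, P S x ∂(Measure.pi fun _ => μ01) =
          ∫ x : Fin K.nv → ℝ, (f - g) (x (K.s e)) (x (K.t e)) *
      ∏ e' ∈ Finset.univ.erase e, (if e' ∈ S then f else g) (x (K.s e')) (x (K.t e'))
        ∂(Measure.pi fun _ => μ01) := by
        rw [← integral_sub (hPi _) (hPi _)]
        congr 1
        ext x
        simp only [P]
        rw [← Finset.mul_prod_erase _ _ (Finset.mem_univ e),
          ← Finset.mul_prod_erase (a := e)
            (f := fun e' => (if e' ∈ S then f else g) (x (K.s e')) (x (K.t e')))
            _ (Finset.mem_univ e)]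
        have : ∏ e' ∈ Finset.univ.erase e, (if e' ∈ insert e S then f else g) (x (K.s e')) (x (K.t e'))
          = ∏ e' ∈ Finset.univ.erase e, (if e' ∈ S then f else g) (x (K.s e')) (x (K.t e')) := by
          refine Finset.prod_congr rfl fun e' he' => ?_
          simp [Finset.mem_insert, Finset.ne_of_mem_erase he']
        rw [this]
        simp only [Finset.mem_insert_self, if_true, he, if_false, Pi.sub_apply]
        ring
      rw [← h2] at h1
      rw [Finset.card_insert_of_notMem he]
      push_cast
      have := abs_sub_le (∫ x, P (insert e S) x ∂(Measure.pi fun _ => μ01))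
        (∫ x, P S x ∂(Measure.pi fun _ => μ01)) (∫ x, P ∅ x ∂(Measure.pi fun _ => μ01))
      linarith
  have := main Finset.univ
  simpa [P, homDensity] using this

lemma cutNorm_le (h : Kern) (ε : ℝ) (hε : 0 ≤ ε) (hc : CutB h ε) : cutNorm h ≤ ε := by
  refine Real.sSup_le ?_ hε
  rintro r ⟨S, T, hS, hT, hS1, hT1, rfl⟩
  have := hc (S.indicator 1) (T.indicator 1) (measurable_one.indicator hS)
    (measurable_one.indicator hT)
    (fun x => by by_cases hx : x ∈ S <;> simp [hx]) (fun x => by by_cases hx : x ∈ T <;> simp [hx])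
  convert this using 2
  have e1 : ∀ (S : Set ℝ), MeasurableSet S → S ⊆ Icc 0 1 → ∀ k : ℝ → ℝ,
      ∫ x in S, k x = ∫ x, k x * S.indicator 1 x ∂μ01 := by
    intro S hS hS1 k
    have : (fun x => k x * S.indicator (1 : ℝ → ℝ) x) = S.indicator k := by
      ext x; by_cases hx : x ∈ S <;> simp [hx]
    rw [this, integral_indicator hS, Measure.restrict_restrict hS, inter_eq_left.2 hS1]
  rw [e1 S hS hS1]
  congr 1
  ext x
  rw [e1 T hT hT1, ← integral_mul_const]
  congr 1
  ext y
  ring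

lemma cell_unique {p : ℕ} {a b : Fin p} {x : ℝ} (ha : x ∈ cell p a) (hb : x ∈ cell p b) :
    a = b := by
  have hp : (0 : ℝ) < p := by exact_mod_cast a.pos
  simp only [cell, Set.mem_Ioc, div_lt_iff₀ hp, le_div_iff₀ hp] at ha hb
  have h1 : ((a : ℕ) : ℝ) < (b : ℕ) + 1 := by linarith
  have h2 : ((b : ℕ) : ℝ) < (a : ℕ) + 1 := by linarith
  have h1' : (a : ℕ) < (b : ℕ) + 1 := by exact_mod_cast h1
  have h2' : (b : ℕ) < (a : ℕ) + 1 := by exact_mod_cast h2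
  apply Fin.ext; omega

lemma cell_exists {p : ℕ} (hp : 0 < p) {x : ℝ} (hx : x ∈ Ioc (0:ℝ) 1) : ∃ a, x ∈ cell p a := by
  have hp' : (0 : ℝ) < p := by exact_mod_cast hp
  have h0 : 0 < x * p := mul_pos hx.1 hp'
  have h1 : 0 < ⌈x * p⌉₊ := Nat.ceil_pos.2 h0
  have h2 : ⌈x * p⌉₊ ≤ p := Nat.ceil_le.2 (by nlinarith [hx.2])
  have h3 := Nat.le_ceil (x * p)
  have h4 := Nat.ceil_lt_add_one h0.le
  refine ⟨⟨⌈x * p⌉₊ - 1, by omega⟩, ?_⟩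
  have h5 : ((⌈x * p⌉₊ - 1 : ℕ) : ℝ) = (⌈x * p⌉₊ : ℝ) - 1 := by
    rw [Nat.cast_sub h1]; simp
  simp only [cell, Set.mem_Ioc, div_lt_iff₀ hp', le_div_iff₀ hp', h5]
  constructor <;> linarith

lemma cell_subset {p : ℕ} (a : Fin p) : cell p a ⊆ Ioc 0 1 := by
  have hp : (0 : ℝ) < p := by exact_mod_cast a.pos
  intro x hx
  simp only [cell, Set.mem_Ioc, div_lt_iff₀ hp, le_div_iff₀ hp] at hx
  have h1 : ((a : ℕ) : ℝ) + 1 ≤ p := by exact_mod_cast a.2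
  have h2 : (0:ℝ) ≤ (a : ℕ) := by positivity
  constructor
  · by_contra h; push Not at h; nlinarith
  · by_contra h; push Not at h; nlinarith

lemma meas_cell {p : ℕ} (a : Fin p) : MeasurableSet (cell p a) := measurableSet_Ioc

lemma vol_cell {p : ℕ} (a : Fin p) : μ01.real (cell p a) = 1 / p := by
  have hp : (0 : ℝ) < p := by exact_mod_cast a.pos
  rw [measureReal_restrict_apply (meas_cell a),
    inter_eq_left.2 ((cell_subset a).trans Ioc_subset_Icc_self)]
  unfold cell
  rw [Real.volume_real_Ioc_of_le]
  · ring
  · gcongr; linarith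

lemma ae_Ioc : ∀ᵐ x ∂μ01, x ∈ Ioc (0:ℝ) 1 := by
  have h : ∀ᵐ x ∂μ01, x ∈ Icc (0:ℝ) 1 := ae_restrict_mem measurableSet_Icc
  have h0 : ∀ᵐ x ∂μ01, x ≠ 0 := by
    apply ae_restrict_of_ae
    simp [ae_iff]
  filter_upwards [h, h0] with x h1 h2
  exact ⟨lt_of_le_of_ne h1.1 (Ne.symm h2), h1.2⟩

lemma stepFn_apply {p : ℕ} (c : Fin p → Fin p → ℝ) {a b : Fin p} {x y : ℝ}
    (hx : x ∈ cell p a) (hy : y ∈ cell p b) : stepFn p c x y = if a ≠ b then c a b else 0 := by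
  unfold stepFn
  rw [Finset.sum_eq_single a, Finset.sum_eq_single b]
  · simp [hx, hy]
  · intro b' _ hb'
    rw [if_neg]; rintro ⟨-, -, h⟩; exact hb' (cell_unique h hy)
  · simp
  · intro a' _ ha'
    apply Finset.sum_eq_zero
    intro b' _
    rw [if_neg]; rintro ⟨-, h, -⟩; exact ha' (cell_unique h hx)
  · simp

lemma stepFn_cases {p : ℕ} (c : Fin p → Fin p → ℝ) (x y : ℝ) :
    (∃ a b, x ∈ cell p a ∧ y ∈ cell p b) ∨ (stepFn p c x y = 0 ∧ stepFn p c y x = 0) := by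
  by_cases h : ∃ a b, x ∈ cell p a ∧ y ∈ cell p b
  · exact Or.inl h
  · right
    push Not at h
    constructor
    · unfold stepFn
      refine Finset.sum_eq_zero fun a _ => Finset.sum_eq_zero fun b _ => ?_
      rw [if_neg]; rintro ⟨-, h1, h2⟩; exact h a b h1 h2
    · unfold stepFn
      refine Finset.sum_eq_zero fun a _ => Finset.sum_eq_zero fun b _ => ?_
      rw [if_neg]; rintro ⟨-, h1, h2⟩; exact h b a h2 h1

lemma stepFn_meas {p : ℕ} (c : Fin p → Fin p → ℝ) : Measurable (Function.uncurry (stepFn p c)) := by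
  unfold stepFn Function.uncurry
  refine Finset.measurable_fun_sum _ fun a _ => Finset.measurable_fun_sum _ fun b _ => ?_
  refine Measurable.ite ?_ measurable_const measurable_const
  by_cases h : a = b
  · simp [h]
  · have : {q : ℝ × ℝ | a ≠ b ∧ q.1 ∈ cell p a ∧ q.2 ∈ cell p b} = cell p a ×ˢ cell p b := by
      ext q; simp [h]
    rw [this]
    exact (meas_cell a).prod (meas_cell b)

lemma stepFn_graphon {p : ℕ} (c : Fin p → Fin p → ℝ) (hs : ∀ a b, c a b = c b a)
    (h01 : ∀ a b, c a b ∈ Icc (0:ℝ) 1) : IsGraphon (stepFn p c) := by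
  refine ⟨⟨stepFn_meas c, fun x y => ?_⟩, fun x y => ?_⟩
  · rcases stepFn_cases c x y with ⟨a, b, h1, h2⟩ | ⟨h1, h2⟩
    · rw [stepFn_apply c h1 h2, stepFn_apply c h2 h1, hs a b]
      simp [eq_comm]
    · rw [h1, h2]
  · rcases stepFn_cases c x y with ⟨a, b, h1, h2⟩ | ⟨h1, h2⟩
    · rw [stepFn_apply c h1 h2]
      split_ifs
      · exact h01 a b
      · simp
    · rw [h1]; simp

lemma ae_pi_Ioc {n : ℕ} : ∀ᵐ x ∂(Measure.pi fun _ : Fin n => μ01), ∀ i, x i ∈ Ioc (0:ℝ) 1 := by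
  rw [ae_all_iff]
  intro i
  exact (measurePreserving_eval (fun _ : Fin n => μ01) i).quasiMeasurePreserving.ae ae_Ioc

lemma homDensity_stepFn (H : MG) {p : ℕ} (hp : 0 < p) (c : Fin p → Fin p → ℝ) :
    homDensity H (stepFn p c) = (1 / (p:ℝ)) ^ H.nv * ∑ φ : Fin H.nv → Fin p,
      ∏ e, (if φ (H.s e) ≠ φ (H.t e) then c (φ (H.s e)) (φ (H.t e)) else 0) := by
  have h1 : homDensity H (stepFn p c) = ∫ x : Fin H.nv → ℝ, ∑ φ : Fin H.nv → Fin p,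
      (Set.pi univ fun i => cell p (φ i)).indicator (fun _ =>
      ∏ e, (if φ (H.s e) ≠ φ (H.t e) then c (φ (H.s e)) (φ (H.t e)) else 0)) x
        ∂(Measure.pi fun _ => μ01) := by
    unfold homDensity
    apply integral_congr_ae
    filter_upwards [ae_pi_Ioc] with x hx
    choose ψ hψ using fun i => cell_exists hp (hx i)
    rw [Finset.sum_eq_single ψ]
    · rw [indicator_of_mem (by simpa [Set.mem_pi] using hψ)]
      exact Finset.prod_congr rfl fun e _ => stepFn_apply c (hψ _) (hψ _)
    · intro φ _ hφ
      rw [indicator_of_notMem]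
      intro hmem
      apply hφ
      ext1 i
      exact cell_unique (hmem i (mem_univ i)) (hψ i)
    · simp
  have hms : ∀ φ : Fin H.nv → Fin p, MeasurableSet (Set.pi univ fun i => cell p (φ i)) :=
    fun φ => MeasurableSet.univ_pi fun i => meas_cell _
  rw [h1, integral_finsetSum _ fun φ _ => (integrable_const _).indicator (hms φ), Finset.mul_sum]
  refine Finset.sum_congr rfl fun φ _ => ?_
  rw [integral_indicator_const _ (hms φ), smul_eq_mul]
  congr 1
  rw [measureReal_def, Measure.pi_pi, ENNReal.toReal_prod]
  have : ∀ i, (μ01 (cell p (φ i))).toReal = 1 / p := fun i => vol_cell (φ i)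
  rw [Finset.prod_congr rfl fun i _ => this i]; simp

lemma integral_stepFn {n : ℕ} (M : Fin n → Fin n → ℝ) (u v : ℝ → ℝ)
    (hu : Integrable u μ01) (hv : Integrable v μ01) :
    ∫ x, ∫ y, stepFn n M x y * (u x * v y) ∂μ01 ∂μ01 =
      ∑ a, ∑ b, (if a ≠ b then M a b else 0) *
        ((∫ x in cell n a, u x ∂μ01) * (∫ y in cell n b, v y ∂μ01)) := by
  have h1 : ∀ x y, stepFn n M x y * (u x * v y) = ∑ a, ∑ b, (if a ≠ b then M a b else 0) *
      ((cell n a).indicator u x * (cell n b).indicator v y) := by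
    intro x y
    unfold stepFn
    rw [Finset.sum_mul]
    refine Finset.sum_congr rfl fun a _ => ?_
    rw [Finset.sum_mul]
    refine Finset.sum_congr rfl fun b _ => ?_
    by_cases h : a = b
    · simp [h]
    · by_cases hx : x ∈ cell n a <;> by_cases hy : y ∈ cell n b <;> simp [h, hx, hy]
  simp only [h1]
  have hv' : ∀ b, Integrable ((cell n b).indicator v) μ01 := fun b => hv.indicator (meas_cell b)
  have hu' : ∀ b, Integrable ((cell n b).indicator u) μ01 := fun b => hu.indicator (meas_cell b)
  have h2 : ∀ x, ∫ y, ∑ a, ∑ b, (if a ≠ b then M a b else 0) *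
      ((cell n a).indicator u x * (cell n b).indicator v y) ∂μ01 =
      ∑ a, ∑ b, (if a ≠ b then M a b else 0) *
      ((cell n a).indicator u x * ∫ y in cell n b, v y ∂μ01) := by
    intro x
    rw [integral_finsetSum _ fun a _ => integrable_finsetSum _ fun b _ =>
      ((hv' b).const_mul _).const_mul _]
    refine Finset.sum_congr rfl fun a _ => ?_
    rw [integral_finsetSum _ fun b _ => ((hv' b).const_mul _).const_mul _]
    refine Finset.sum_congr rfl fun b _ => ?_
    rw [integral_const_mul, integral_const_mul, integral_indicator (meas_cell b)]
  simp only [h2]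
  rw [integral_finsetSum _ fun a _ => integrable_finsetSum _ fun b _ =>
      ((hu' a).mul_const _).const_mul _]
  refine Finset.sum_congr rfl fun a _ => ?_
  rw [integral_finsetSum _ fun b _ => ((hu' a).mul_const _).const_mul _]
  refine Finset.sum_congr rfl fun b _ => ?_
  rw [integral_const_mul, integral_mul_const, integral_indicator (meas_cell a)]

/-- Dot product on `(ℤ/q)²`. -/
def dotq {q : ℕ} (i j : ZMod q × ZMod q) : ZMod q := i.1 * j.1 + i.2 * j.2

lemma dotq_comm {q : ℕ} (i j : ZMod q × ZMod q) : dotq i j = dotq j i := by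
  unfold dotq; ring

lemma dot_orth {q : ℕ} [Fact q.Prime] (j j' : ZMod q × ZMod q)
    (hdet : j.1 * j'.2 - j.2 * j'.1 ≠ 0) (g g' : ZMod q → ℝ) (hg : ∑ z, g z = 0) :
    ∑ i, g (dotq i j) * g' (dotq i j') = 0 := by
  let T : ZMod q × ZMod q → ZMod q × ZMod q := fun i => (dotq i j, dotq i j')
  have hinj : Function.Injective T := by
    rintro ⟨a, b⟩ ⟨c, d⟩ h
    simp only [T, dotq, Prod.mk.injEq] at h
    obtain ⟨h1, h2⟩ := h
    have e1 : (a - c) * (j.1 * j'.2 - j.2 * j'.1) = 0 := by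
      linear_combination j'.2 * h1 - j.2 * h2
    have e2 : (b - d) * (j.1 * j'.2 - j.2 * j'.1) = 0 := by
      linear_combination (-j'.1) * h1 + j.1 * h2
    have e1' := (mul_eq_zero.1 e1).resolve_right hdet
    have e2' := (mul_eq_zero.1 e2).resolve_right hdet
    rw [sub_eq_zero.1 e1', sub_eq_zero.1 e2']
  have hbij : Function.Bijective T := Finite.injective_iff_bijective.1 hinj
  have := hbij.sum_comp (fun z : ZMod q × ZMod q => g z.1 * g' z.2)
  simp only [T] at this
  rw [this, Fintype.sum_prod_type]
  simp only [← Finset.mul_sum, ← Finset.sum_mul, hg, zero_mul]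

lemma dep_card {q : ℕ} [Fact q.Prime] :
    (Finset.univ.filter fun z : (ZMod q × ZMod q) × (ZMod q × ZMod q) =>
      z.1.1 * z.2.2 - z.1.2 * z.2.1 = 0).card ≤ 2 * q ^ 3 := by
  let T1 : Finset ((ZMod q × ZMod q) × (ZMod q × ZMod q)) :=
    Finset.univ.image (fun w : (ZMod q × ZMod q) × ZMod q => (w.1, (w.2 * w.1.1, w.2 * w.1.2)))
  let T2 : Finset ((ZMod q × ZMod q) × (ZMod q × ZMod q)) :=
    Finset.univ.image (fun w : (ZMod q × ZMod q) => ((0, 0), w))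
  have hsub : (Finset.univ.filter fun z : (ZMod q × ZMod q) × (ZMod q × ZMod q) =>
      z.1.1 * z.2.2 - z.1.2 * z.2.1 = 0) ⊆ T1 ∪ T2 := by
    rintro ⟨⟨a, b⟩, ⟨c, d⟩⟩ hz
    simp only [Finset.mem_filter, Finset.mem_univ, true_and] at hz
    rw [Finset.mem_union]
    by_cases ha : a = 0
    · by_cases hb : b = 0
      · right
        simp only [T2, Finset.mem_image, Finset.mem_univ, true_and]
        exact ⟨(c, d), by simp [ha, hb]⟩
      · left
        simp only [T1, Finset.mem_image, Finset.mem_univ, true_and]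
        refine ⟨((a, b), d / b), ?_⟩
        have hc : c = 0 := by
          rw [ha] at hz
          have : b * c = 0 := by linear_combination -hz
          exact (mul_eq_zero.1 this).resolve_left hb
        simp [ha, hc, hb]
    · left
      simp only [T1, Finset.mem_image, Finset.mem_univ, true_and]
      refine ⟨((a, b), c / a), ?_⟩
      simp only [Prod.mk.injEq, true_and]
      refine ⟨by field_simp, ?_⟩
      field_simp
      linear_combination -hz
  have c1 : T1.card ≤ q ^ 3 := by
    refine Finset.card_image_le.trans ?_
    simp [Fintype.card_prod, ZMod.card]; apply le_of_eq; ring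
  have c2 : T2.card ≤ q ^ 2 := by
    refine Finset.card_image_le.trans ?_
    simp [Fintype.card_prod, ZMod.card]; apply le_of_eq; ring
  have hq : 1 ≤ q := (Fact.out : q.Prime).one_le
  have : q ^ 2 ≤ q ^ 3 := Nat.pow_le_pow_right hq (by norm_num)
  have := Finset.card_le_card hsub
  have := Finset.card_union_le T1 T2
  omega

lemma discrete_bound {p q : ℕ} [Fact q.Prime] (g : Fin p → Fin p → ZMod q → ℝ)
    (hg1 : ∀ a b z, |g a b z| ≤ 1) (hg0 : ∀ a b, ∑ z, g a b z = 0)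
    (u v : Fin p × (ZMod q × ZMod q) → ℝ) (hu : ∀ x, |u x| ≤ 1) (hv : ∀ x, |v x| ≤ 1) :
    (∑ x, ∑ y, g x.1 y.1 (dotq x.2 y.2) * (u x * v y)) ^ 2 ≤ 2 / q * ((p * (q * q) : ℝ) ^ 2) ^ 2 := by
  have hq : (0:ℝ) < q := by exact_mod_cast (Fact.out : q.Prime).pos
  have hcard : (Fintype.card (Fin p × (ZMod q × ZMod q)) : ℝ) = p * (q * q) := by
    simp [Fintype.card_prod, ZMod.card]
  let S : Fin p × (ZMod q × ZMod q) → ℝ := fun x => ∑ y, g x.1 y.1 (dotq x.2 y.2) * v y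
  have e1 : ∑ x, ∑ y, g x.1 y.1 (dotq x.2 y.2) * (u x * v y) = ∑ x, u x * S x := by
    refine Finset.sum_congr rfl fun x _ => ?_
    rw [Finset.mul_sum]
    exact Finset.sum_congr rfl fun y _ => by ring
  rw [e1]
  have e2 : ∑ x, u x ^ 2 ≤ p * (q * q) := by
    calc ∑ x, u x ^ 2 ≤ ∑ x : Fin p × (ZMod q × ZMod q), (1:ℝ) :=
          Finset.sum_le_sum fun x _ => by
            rw [← sq_abs]; exact pow_le_one₀ (abs_nonneg _) (hu x)
      _ = _ := by rw [Finset.sum_const, Finset.card_univ, nsmul_eq_mul, mul_one, hcard]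
  have e3 : ∑ x, S x ^ 2 = ∑ y, ∑ y', v y * v y' *
      ∑ x : Fin p × (ZMod q × ZMod q), g x.1 y.1 (dotq x.2 y.2) * g x.1 y'.1 (dotq x.2 y'.2) := by
    simp only [S, sq, Finset.sum_mul_sum]
    simp only [Finset.mul_sum]
    rw [Finset.sum_comm]
    refine Finset.sum_congr rfl fun y _ => ?_
    rw [Finset.sum_comm]
    refine Finset.sum_congr rfl fun y' _ => ?_
    exact Finset.sum_congr rfl fun x _ => by ring
  have e4 : ∀ y y' : Fin p × (ZMod q × ZMod q), v y * v y' *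
      ∑ x : Fin p × (ZMod q × ZMod q), g x.1 y.1 (dotq x.2 y.2) * g x.1 y'.1 (dotq x.2 y'.2)
      ≤ if y.2.1 * y'.2.2 - y.2.2 * y'.2.1 = 0 then (p * (q * q) : ℝ) else 0 := by
    intro y y'
    split_ifs with h
    · refine (le_abs_self _).trans ?_
      rw [abs_mul, abs_mul]
      have b1 : |v y| * |v y'| ≤ 1 := mul_le_one₀ (hv y) (abs_nonneg _) (hv y')
      have b2 : |∑ x : Fin p × (ZMod q × ZMod q), g x.1 y.1 (dotq x.2 y.2) * g x.1 y'.1 (dotq x.2 y'.2)|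
          ≤ p * (q * q) := by
        rw [← hcard]
        refine (Finset.abs_sum_le_sum_abs _ _).trans ?_
        calc _ ≤ ∑ x : Fin p × (ZMod q × ZMod q), (1:ℝ) := Finset.sum_le_sum fun x _ => by
              rw [abs_mul]; exact mul_le_one₀ (hg1 _ _ _) (abs_nonneg _) (hg1 _ _ _)
          _ = _ := by simp
      calc _ ≤ 1 * (p * (q * q) : ℝ) := mul_le_mul b1 b2 (abs_nonneg _) zero_le_one
        _ = _ := one_mul _
    · rw [Fintype.sum_prod_type]
      have : ∀ a : Fin p, ∑ i, g (a, i).1 y.1 (dotq (a, i).2 y.2) * g (a, i).1 y'.1 (dotq (a, i).2 y'.2) = 0 :=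
        fun a => dot_orth y.2 y'.2 h (g a y.1) (g a y'.1) (hg0 a y.1)
      rw [Finset.sum_eq_zero fun a _ => this a, mul_zero]
  have e5 : ∑ y : Fin p × (ZMod q × ZMod q), ∑ y' : Fin p × (ZMod q × ZMod q),
      (if y.2.1 * y'.2.2 - y.2.2 * y'.2.1 = 0 then (p * (q * q) : ℝ) else 0)
      ≤ p * p * (2 * q ^ 3) * (p * (q * q)) := by
    have hc := dep_card (q := q)
    have hc' : (((Finset.univ.filter fun z : (ZMod q × ZMod q) × (ZMod q × ZMod q) =>
      z.1.1 * z.2.2 - z.1.2 * z.2.1 = 0).card : ℕ) : ℝ) ≤ 2 * q ^ 3 := by exact_mod_cast hc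
    have : ∑ j : ZMod q × ZMod q, ∑ j' : ZMod q × ZMod q,
        (if j.1 * j'.2 - j.2 * j'.1 = 0 then (p * (q * q) : ℝ) else 0) ≤ 2 * q ^ 3 * (p * (q * q)) := by
      rw [← Fintype.sum_prod_type (f := fun z : (ZMod q × ZMod q) × (ZMod q × ZMod q) =>
        if z.1.1 * z.2.2 - z.1.2 * z.2.1 = 0 then (p * (q * q) : ℝ) else 0),
        ← Finset.sum_filter, Finset.sum_const, nsmul_eq_mul]
      exact mul_le_mul_of_nonneg_right hc' (by positivity)
    have hs : ∀ K : ZMod q × ZMod q → ℝ, ∑ y : Fin p × (ZMod q × ZMod q), K y.2 = p * ∑ j, K j := by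
      intro K
      rw [Fintype.sum_prod_type]
      simp
    have h1 : ∀ y : Fin p × (ZMod q × ZMod q), ∑ y' : Fin p × (ZMod q × ZMod q),
      (if y.2.1 * y'.2.2 - y.2.2 * y'.2.1 = 0 then (p * (q * q) : ℝ) else 0) =
        p * ∑ j' : ZMod q × ZMod q, if y.2.1 * j'.2 - y.2.2 * j'.1 = 0 then (p * (q * q) : ℝ) else 0 :=
      fun y => hs (fun j' => if y.2.1 * j'.2 - y.2.2 * j'.1 = 0 then (p * (q * q) : ℝ) else 0)
    rw [Finset.sum_congr rfl fun y _ => h1 y,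
      hs (fun j => p * ∑ j' : ZMod q × ZMod q, if j.1 * j'.2 - j.2 * j'.1 = 0 then (p * (q * q) : ℝ) else 0),
      ← Finset.mul_sum]
    have hp0 : (0:ℝ) ≤ p * p := by positivity
    nlinarith [mul_le_mul_of_nonneg_left this hp0]
  have cs := Finset.sum_mul_sq_le_sq_mul_sq Finset.univ u S
  have e6 : ∑ x, S x ^ 2 ≤ p * p * (2 * q ^ 3) * (p * (q * q)) := by
    rw [e3]
    exact (Finset.sum_le_sum fun y _ => Finset.sum_le_sum fun y' _ => e4 y y').trans e5
  refine cs.trans ((mul_le_mul e2 e6 (Finset.sum_nonneg fun _ _ => sq_nonneg _)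
    (by positivity)).trans (le_of_eq ?_))
  field_simp

/-- Bounded measurable kernels. -/
def BM (h : Kern) : Prop := Measurable (Function.uncurry h) ∧ ∃ C : ℝ, ∀ x y, |h x y| ≤ C

lemma BM.integrable {h : Kern} (hh : BM h) {u v : ℝ → ℝ} (hu : Measurable u) (hv : Measurable v)
    (hu1 : ∀ x, |u x| ≤ 1) (hv1 : ∀ x, |v x| ≤ 1) :
    Integrable (fun z : ℝ × ℝ => h z.1 z.2 * (u z.1 * v z.2)) (μ01.prod μ01) := by
  obtain ⟨hm, C, hC⟩ := hh
  refine Integrable.of_bound (C := C) ?_ ?_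
  · exact (hm.mul ((hu.comp measurable_fst).mul (hv.comp measurable_snd))).aestronglyMeasurable
  · refine Eventually.of_forall fun z => ?_
    rw [Real.norm_eq_abs, abs_mul, abs_mul]
    have := mul_le_one₀ (hu1 z.1) (abs_nonneg (v z.2)) (hv1 z.2)
    calc _ ≤ |h z.1 z.2| * 1 := mul_le_mul_of_nonneg_left this (abs_nonneg _)
      _ ≤ C := by rw [mul_one]; exact hC _ _

lemma CutB_add {h h' : Kern} (hh : BM h) (hh' : BM h') {ε ε' : ℝ} (H : CutB h ε) (H' : CutB h' ε') :
    CutB (h + h') (ε + ε') := by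
  intro u v hu hv hu1 hv1
  have i1 := hh.integrable hu hv hu1 hv1
  have i2 := hh'.integrable hu hv hu1 hv1
  have a1 := H u v hu hv hu1 hv1
  have a2 := H' u v hu hv hu1 hv1
  have e : ∫ x, ∫ y, (h + h') x y * (u x * v y) ∂μ01 ∂μ01 =
      (∫ x, ∫ y, h x y * (u x * v y) ∂μ01 ∂μ01) + ∫ x, ∫ y, h' x y * (u x * v y) ∂μ01 ∂μ01 := by
    have := integral_add i1 i2
    rw [← integral_prod _ i1, ← integral_prod _ i2, ← this]
    have h3 := integral_prod _ (i1.add i2)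
    simp only [Pi.add_apply] at h3
    rw [h3]
    simp [add_mul]
  rw [e]
  exact (abs_add_le _ _).trans (add_le_add a1 a2)

lemma CutB_L1 {h : Kern} (hh : BM h) {ε : ℝ} (k : ℝ × ℝ → ℝ) (hk : Integrable k (μ01.prod μ01))
    (hle : ∀ᵐ z ∂(μ01.prod μ01), |h z.1 z.2| ≤ k z) (hε : ∫ z, k z ∂(μ01.prod μ01) ≤ ε) :
    CutB h ε := by
  intro u v hu hv hu1 hv1
  rw [← integral_prod _ (hh.integrable hu hv hu1 hv1)]
  rw [← Real.norm_eq_abs]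
  refine le_trans (norm_integral_le_of_norm_le hk ?_) hε
  filter_upwards [hle] with z hz
  rw [Real.norm_eq_abs, abs_mul, abs_mul]
  have := mul_le_one₀ (hu1 z.1) (abs_nonneg (v z.2)) (hv1 z.2)
  calc _ ≤ |h z.1 z.2| * 1 := mul_le_mul_of_nonneg_left this (abs_nonneg _)
    _ ≤ _ := by rw [mul_one]; exact hz

lemma CutB_step {n : ℕ} (hn : 0 < n) (M : Fin n → Fin n → ℝ) (hM : ∀ a b, |M a b| ≤ 1) (κ : ℝ)
    (hκ : ∀ U V : Fin n → ℝ, (∀ a, |U a| ≤ 1) → (∀ a, |V a| ≤ 1) →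
      |∑ a, ∑ b, M a b * (U a * V b)| ≤ κ * (n:ℝ) ^ 2) :
    CutB (stepFn n M) (κ + 1 / n) := by
  have hn' : (0:ℝ) < n := by exact_mod_cast hn
  intro u v hu hv hu1 hv1
  have ii : ∀ w : ℝ → ℝ, Measurable w → (∀ x, |w x| ≤ 1) → Integrable w μ01 := fun w hw hw1 =>
    Integrable.of_bound hw.aestronglyMeasurable 1 (Eventually.of_forall hw1)
  rw [integral_stepFn M u v (ii u hu hu1) (ii v hv hv1)]
  have bd : ∀ w : ℝ → ℝ, (∀ x, |w x| ≤ 1) → ∀ a : Fin n, |n * ∫ x in cell n a, w x ∂μ01| ≤ 1 := by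
    intro w hw1 a
    have := norm_setIntegral_le_of_norm_le_const (μ := μ01) (s := cell n a) (f := w) (C := 1)
      (measure_lt_top _ _) (fun x _ => hw1 x)
    rw [vol_cell a, Real.norm_eq_abs, one_mul] at this
    rw [abs_mul, abs_of_pos hn']
    calc _ ≤ (n:ℝ) * (1 / n) := mul_le_mul_of_nonneg_left this hn'.le
      _ = 1 := by field_simp
  set U : Fin n → ℝ := fun a => n * ∫ x in cell n a, u x ∂μ01 with hU
  set V : Fin n → ℝ := fun a => n * ∫ x in cell n a, v x ∂μ01 with hV
  have hU1 : ∀ a, |U a| ≤ 1 := bd u hu1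
  have hV1 : ∀ a, |V a| ≤ 1 := bd v hv1
  have e1 : ∑ a, ∑ b, (if a ≠ b then M a b else 0) *
        ((∫ x in cell n a, u x ∂μ01) * (∫ y in cell n b, v y ∂μ01)) =
      ((∑ a, ∑ b, M a b * (U a * V b)) - ∑ a, M a a * (U a * V a)) / (n:ℝ) ^ 2 := by
    rw [← Finset.sum_sub_distrib, Finset.sum_div]
    refine Finset.sum_congr rfl fun a _ => ?_
    have : M a a * (U a * V a) = ∑ b, if a = b then M a b * (U a * V b) else 0 := by simp
    rw [this, ← Finset.sum_sub_distrib, Finset.sum_div]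
    refine Finset.sum_congr rfl fun b _ => ?_
    by_cases h : a = b
    · simp [h]
    · simp only [h, ne_eq, not_false_eq_true, if_true, if_false, hU, hV]
      field_simp
      ring
  rw [e1, abs_div, abs_of_pos (by positivity : (0:ℝ) < (n:ℝ) ^ 2), div_le_iff₀ (by positivity)]
  have d1 : |∑ a, M a a * (U a * V a)| ≤ n := by
    refine (Finset.abs_sum_le_sum_abs _ _).trans ?_
    calc _ ≤ ∑ a : Fin n, (1:ℝ) := Finset.sum_le_sum fun a _ => by
          rw [abs_mul, abs_mul]
          exact mul_le_one₀ (hM a a) (by positivity) (mul_le_one₀ (hU1 a) (abs_nonneg _) (hV1 a))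
      _ = n := by simp
  have d2 := hκ U V hU1 hV1
  have d3 := abs_sub (∑ a, ∑ b, M a b * (U a * V b)) (∑ a, M a a * (U a * V a))
  have : (κ + 1 / n) * (n:ℝ) ^ 2 = κ * (n:ℝ) ^ 2 + n := by field_simp
  linarith

/-- Fraction of residues below `q c`. -/
noncomputable def meanq (q : ℕ) [NeZero q] (c : ℝ) : ℝ :=
  (∑ z : ZMod q, if ((z.val : ℕ) : ℝ) < q * c then (1:ℝ) else 0) / q

lemma meanq_bd (q : ℕ) [NeZero q] (c : ℝ) (hc : c ∈ Icc (0:ℝ) 1) :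
    |c - meanq q c| ≤ 1 / q ∧ meanq q c ∈ Icc (0:ℝ) 1 := by
  have hq : (0:ℝ) < q := by exact_mod_cast Nat.pos_of_ne_zero (NeZero.ne q)
  have hcount : ∑ z : ZMod q, (if ((z.val : ℕ) : ℝ) < q * c then (1:ℝ) else 0) = ⌈q * c⌉₊ := by
    have hle : ⌈q * c⌉₊ ≤ q := Nat.ceil_le.2 (by nlinarith [hc.2])
    have h1 : ∑ z : ZMod q, (if ((z.val : ℕ) : ℝ) < q * c then (1:ℝ) else 0) =
        ∑ k : Fin q, if (k : ℕ) < ⌈q * c⌉₊ then (1:ℝ) else 0 := by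
      refine Finset.sum_nbij' (fun z => ⟨z.val, ZMod.val_lt z⟩) (fun k => ((k : ℕ) : ZMod q))
        (by simp) (by simp) ?_ ?_ ?_
      · intro z _; simp
      · intro k _; apply Fin.ext; simp [ZMod.val_natCast, Nat.mod_eq_of_lt k.2]
      · intro z _; simp only [Nat.lt_ceil]
    rw [h1, Fin.sum_univ_eq_sum_range (fun k => if k < ⌈q * c⌉₊ then (1:ℝ) else 0) q,
      ← Finset.sum_filter]
    have : (Finset.range q).filter (fun k => k < ⌈q * c⌉₊) = Finset.range ⌈q * c⌉₊ := by
      ext k; simp; omega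
    rw [this]; simp
  have h1 := Nat.le_ceil (q * c)
  have h2 := Nat.ceil_lt_add_one (by nlinarith [hc.1] : 0 ≤ q * c)
  have hle : (⌈q * c⌉₊ : ℝ) ≤ q := by exact_mod_cast Nat.ceil_le.2 (by nlinarith [hc.2])
  unfold meanq
  rw [hcount]
  refine ⟨?_, by positivity, by rw [div_le_one hq]; exact hle⟩
  have : c - ⌈q * c⌉₊ / q = (q * c - ⌈q * c⌉₊) / q := by field_simp
  rw [this, abs_div, abs_of_pos hq]
  gcongr
  rw [abs_le]; constructor <;> linarith

lemma exists_cont (f : Kern) (hf : IsGraphon f) (ε : ℝ) (hε : 0 < ε) :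
    ∃ g : Kern, IsGraphon g ∧ CutB (f - g) ε ∧
      UniformContinuous (Function.uncurry g) := by
  have hfi : Integrable (Function.uncurry f) (μ01.prod μ01) :=
    Integrable.of_bound hf.1.1.aestronglyMeasurable 1
      (Eventually.of_forall fun z => graphon_abs hf z.1 z.2)
  obtain ⟨g0, hcs, hintg, hcont, hgi⟩ := hfi.exists_hasCompactSupport_integral_sub_le hε
  have huc : UniformContinuous g0 := hcs.uniformContinuous_of_continuous hcont
  let g : Kern := fun x y => max 0 (min 1 ((g0 (x, y) + g0 (y, x)) / 2))
  have hgc : Continuous (Function.uncurry g) := by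
    unfold Function.uncurry
    simp only [g]
    fun_prop
  have hg : IsGraphon g := by
    refine ⟨⟨hgc.measurable, fun x y => ?_⟩, fun x y => ?_⟩
    · simp only [g, add_comm]
    · simp [g]
  refine ⟨g, hg, ?_, ?_⟩
  · have hd : Integrable (fun z : ℝ × ℝ => ‖Function.uncurry f z - g0 z‖) (μ01.prod μ01) :=
      (hfi.sub hgi).norm
    have hd' : Integrable (fun z : ℝ × ℝ => ‖Function.uncurry f z.swap - g0 z.swap‖) (μ01.prod μ01) :=
      hd.swap
    refine CutB_L1 ⟨graphon_sub_meas hf hg, 1, graphon_sub_bd hf hg⟩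
      (fun z => (‖Function.uncurry f z - g0 z‖ + ‖Function.uncurry f z.swap - g0 z.swap‖) / 2)
      ((hd.add hd').div_const 2) ?_ ?_
    · refine Eventually.of_forall fun ⟨x, y⟩ => ?_
      have h1 := hf.2 x y
      have h2 := hf.1.2 x y
      simp only [Pi.sub_apply, g, Function.uncurry, Prod.swap, Real.norm_eq_abs, ← h2]
      set s := (g0 (x, y) + g0 (y, x)) / 2 with hs
      have h3 : |f x y - max 0 (min 1 s)| ≤ |f x y - s| := by
        have e : f x y = max 0 (min 1 (f x y)) := by
          rw [min_eq_right h1.2, max_eq_right h1.1]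
        conv_lhs => rw [e]
        refine (abs_max_sub_max_le_max _ _ _ _).trans ?_
        refine max_le (by simp) ?_
        refine (abs_min_sub_min_le_max _ _ _ _).trans ?_
        exact max_le (by simp) le_rfl
      refine h3.trans ?_
      have : f x y - s = ((f x y - g0 (x, y)) + (f x y - g0 (y, x))) / 2 := by rw [hs]; ring
      rw [this, abs_div, abs_two]
      gcongr
      exact abs_add_le _ _
    · rw [integral_div, integral_add hd hd']
      have : ∫ z : ℝ × ℝ, ‖Function.uncurry f z.swap - g0 z.swap‖ ∂(μ01.prod μ01) =
          ∫ z : ℝ × ℝ, ‖Function.uncurry f z - g0 z‖ ∂(μ01.prod μ01) :=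
        integral_prod_swap (fun z : ℝ × ℝ => ‖Function.uncurry f z - g0 z‖)
      rw [this]; linarith
  · have hclip : LipschitzWith 1 (fun s : ℝ => max 0 (min 1 s)) := by
      have := (LipschitzWith.id (α := ℝ)).const_min 1
      exact this.const_max 0
    have hs : UniformContinuous (fun z : ℝ × ℝ => (g0 z + g0 z.swap) / 2) := by
      have h1 := huc.add (huc.comp uniformContinuous_swap)
      have h2 := (Real.uniformContinuous_const_mul (x := (2⁻¹ : ℝ))).comp h1
      convert h2 using 2 with z
      simp only [Function.comp]
      ring
    exact hclip.uniformContinuous.comp hs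

lemma near_diag_bd (n : ℕ) (hn : 0 < n) :
    Integrable (fun z : ℝ × ℝ => if |z.1 - z.2| ≤ 1 / (n:ℝ) then (1:ℝ) else 0) (μ01.prod μ01) ∧
    ∫ z : ℝ × ℝ, (if |z.1 - z.2| ≤ 1 / (n:ℝ) then (1:ℝ) else 0) ∂(μ01.prod μ01) ≤ 2 / n := by
  have hn' : (0:ℝ) < n := by exact_mod_cast hn
  have hm : MeasurableSet {z : ℝ × ℝ | |z.1 - z.2| ≤ 1 / (n:ℝ)} :=
    measurableSet_le (by fun_prop) measurable_const
  have hi : Integrable (fun z : ℝ × ℝ => if |z.1 - z.2| ≤ 1 / (n:ℝ) then (1:ℝ) else 0)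
      (μ01.prod μ01) := by
    refine Integrable.of_bound (C := 1)
      (Measurable.ite hm measurable_const measurable_const).aestronglyMeasurable ?_
    exact Eventually.of_forall fun z => by split_ifs <;> simp
  refine ⟨hi, ?_⟩
  rw [integral_prod _ hi]
  have key : ∀ x : ℝ, ‖∫ y, (if |x - y| ≤ 1 / (n:ℝ) then (1:ℝ) else 0) ∂μ01‖ ≤ 2 / n := by
    intro x
    have e : (fun y => if |x - y| ≤ 1 / (n:ℝ) then (1:ℝ) else 0) =
        (Icc (x - 1 / n) (x + 1 / n)).indicator (fun _ => (1:ℝ)) := by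
      ext y
      by_cases h : |x - y| ≤ 1 / (n:ℝ)
      · rw [if_pos h, indicator_of_mem]
        rw [abs_le] at h; constructor <;> linarith
      · rw [if_neg h, indicator_of_notMem]
        intro hy; apply h; rw [abs_le]; constructor <;> linarith [hy.1, hy.2]
    rw [e, integral_indicator_const _ measurableSet_Icc, smul_eq_mul, mul_one, Real.norm_eq_abs,
      abs_of_nonneg measureReal_nonneg]
    have h1 : μ01.real (Icc (x - 1 / n) (x + 1 / n)) ≤ volume.real (Icc (x - 1 / (n:ℝ)) (x + 1 / n)) := by
      refine ENNReal.toReal_mono ?_ (Measure.restrict_apply_le _ _)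
      simp
    refine h1.trans ?_
    rw [Real.volume_real_Icc_of_le (by linarith [show (0:ℝ) < 1 / n by positivity])]
    apply le_of_eq; ring
  have := norm_integral_le_of_norm_le_const (μ := μ01) (Eventually.of_forall key)
  refine (le_abs_self _).trans ?_
  simpa using this

lemma exists_step01 (f : Kern) (hf : IsGraphon f) (ε : ℝ) (hε : 0 < ε) :
    ∃ g ∈ StepGraphons, (∀ x y : ℝ, g x y = 0 ∨ g x y = 1) ∧ CutB (f - g) ε := by
  set η := ε / 8 with hη
  have hη0 : 0 < η := by positivity
  obtain ⟨g', hg', hfg', huc⟩ := exists_cont f hf (2 * η) (by positivity)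
  obtain ⟨δ, hδ, huc'⟩ := Metric.uniformContinuous_iff.1 huc η hη0
  obtain ⟨p, hp⟩ := exists_nat_gt (1 / δ + 2 / η)
  have hp0 : (0:ℝ) < p := lt_trans (by positivity) hp
  have hp0' : 0 < p := by exact_mod_cast hp0
  have hpδ : 1 / (p:ℝ) < δ := by
    rw [div_lt_comm₀ hp0 hδ]; linarith [show 0 < 2 / η by positivity]
  have hpη : 2 / (p:ℝ) ≤ η := by
    rw [div_le_comm₀ hp0 hη0]; linarith [show 0 < 1 / δ by positivity]
  obtain ⟨N, hN⟩ := exists_nat_gt (2 / η ^ 2 + 1 / η)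
  obtain ⟨q, hqN, hqp⟩ := Nat.exists_infinite_primes N
  haveI : Fact q.Prime := ⟨hqp⟩
  have hq0 : (0:ℝ) < q := by exact_mod_cast hqp.pos
  have hqN' : (N:ℝ) ≤ q := by exact_mod_cast hqN
  have hq1 : 2 / (q:ℝ) ≤ η ^ 2 := by
    rw [div_le_comm₀ hq0 (by positivity)]; linarith [show 0 < 1 / η by positivity]
  have hq2 : 1 / (q:ℝ) ≤ η := by
    rw [div_le_comm₀ hq0 (by positivity)]; linarith [show 0 < 2 / η ^ 2 by positivity]
  set n := p * (q * q) with hn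
  have hn0 : 0 < n := by have := hqp.pos; positivity
  have hn0' : (0:ℝ) < n := by exact_mod_cast hn0
  have hnp : (p:ℝ) ≤ n := by
    have : p * 1 ≤ p * (q * q) := Nat.mul_le_mul_left p (Nat.mul_pos hqp.pos hqp.pos)
    rw [mul_one] at this
    exact_mod_cast this
  have hn2 : 2 / (n:ℝ) ≤ η := le_trans (by gcongr) hpη
  have hn1 : 1 / (n:ℝ) ≤ η := le_trans (by gcongr; norm_num) hn2
  have hn1δ : 1 / (n:ℝ) < δ := lt_of_le_of_lt (by gcongr) hpδ
  let eq : Fin (q * q) ≃ ZMod q × ZMod q :=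
    (Fintype.equivFinOfCardEq (by simp [Fintype.card_prod, ZMod.card])).symm
  let E : Fin n ≃ Fin p × (ZMod q × ZMod q) :=
    finProdFinEquiv.symm.trans (Equiv.prodCongr (Equiv.refl _) eq)
  let pt : Fin n → ℝ := fun α => (((E α).1 : ℕ) : ℝ) / p
  have hpt : ∀ (α : Fin n) (x : ℝ), x ∈ cell n α → |x - pt α| < δ := by
    intro α x hx
    obtain ⟨⟨a, r⟩, rfl⟩ := (finProdFinEquiv (m := p) (n := q * q)).surjective α
    have e1 : pt (finProdFinEquiv (a, r)) = ((a : ℕ) : ℝ) / p := by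
      simp [pt, E]
    rw [e1]
    have e2 : ((finProdFinEquiv (a, r) : Fin n) : ℕ) = (r : ℕ) + q * q * (a : ℕ) := rfl
    simp only [cell, e2, Set.mem_Ioc] at hx
    rw [div_lt_iff₀ hn0', le_div_iff₀ hn0'] at hx
    have hnc : (n:ℝ) = p * (q * q) := by rw [hn]; push_cast; ring
    have hr : ((r : ℕ) : ℝ) + 1 ≤ q * q := by exact_mod_cast r.2
    push_cast at hx
    rw [hnc] at hx
    have hqq : (0:ℝ) < q * q := by positivity
    have l1 : ((a : ℕ) : ℝ) < x * p := by
      have : (0:ℝ) ≤ (r : ℕ) := by positivity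
      by_contra hcon; push Not at hcon
      nlinarith [hx.1]
    have l2 : x * p ≤ (a : ℕ) + 1 := by
      by_contra hcon; push Not at hcon
      nlinarith [hx.2]
    refine lt_of_le_of_lt ?_ hpδ
    have : x - ((a : ℕ) : ℝ) / p = (x * p - (a : ℕ)) / p := by field_simp
    rw [this, abs_div, abs_of_pos hp0]
    gcongr
    rw [abs_le]; constructor <;> linarith
  let C : Fin p → Fin p → ℝ := fun a b => g' (((a : ℕ) : ℝ) / p) (((b : ℕ) : ℝ) / p)
  have hC01 : ∀ a b, C a b ∈ Icc (0:ℝ) 1 := fun a b => hg'.2 _ _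
  have hCs : ∀ a b, C a b = C b a := fun a b => hg'.1.2 _ _
  let χ : Fin p → Fin p → ZMod q → ℝ := fun a b z =>
    if ((z.val : ℕ) : ℝ) < q * C a b then (1:ℝ) else 0
  have hχ : ∀ a b z, χ a b z = 0 ∨ χ a b z = 1 := by
    intro a b z; simp only [χ]; split_ifs <;> simp
  let X : Fin n → Fin n → ℝ := fun α β => χ (E α).1 (E β).1 (dotq (E α).2 (E β).2)
  let D : Fin n → Fin n → ℝ := fun α β => C (E α).1 (E β).1
  have hXs : ∀ α β, X α β = X β α := by
    intro α β
    simp only [X, χ, dotq_comm (E α).2, hCs (E α).1]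
  have hX : ∀ α β, X α β = 0 ∨ X α β = 1 := fun α β => hχ _ _ _
  have hX01 : ∀ α β, X α β ∈ Icc (0:ℝ) 1 := by
    intro α β; rcases hX α β with h | h <;> simp [h]
  have hgX : IsGraphon (stepFn n X) := stepFn_graphon X hXs hX01
  have hgD : IsGraphon (stepFn n D) := stepFn_graphon D (fun _ _ => hCs _ _) (fun _ _ => hC01 _ _)
  refine ⟨stepFn n X, ⟨hgX, n, X, rfl⟩, ?_, ?_⟩
  · intro x y
    rcases stepFn_cases X x y with ⟨a, b, h1, h2⟩ | ⟨h1, -⟩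
    · rw [stepFn_apply X h1 h2]
      split_ifs
      · exact hX a b
      · simp
    · exact Or.inl h1
  have c1 : CutB (g' - stepFn n D) (2 * η) := by
    obtain ⟨i1, i2⟩ := near_diag_bd n hn0
    refine CutB_L1 ⟨graphon_sub_meas hg' hgD, 1, graphon_sub_bd hg' hgD⟩
      (fun z => η + if |z.1 - z.2| ≤ 1 / (n:ℝ) then (1:ℝ) else 0)
      ((integrable_const η).add i1) ?_ ?_
    · have a1 : ∀ᵐ z ∂(μ01.prod μ01), z.1 ∈ Ioc (0:ℝ) 1 :=
        Measure.quasiMeasurePreserving_fst.ae ae_Ioc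
      have a2 : ∀ᵐ z ∂(μ01.prod μ01), z.2 ∈ Ioc (0:ℝ) 1 :=
        Measure.quasiMeasurePreserving_snd.ae ae_Ioc
      filter_upwards [a1, a2] with z h1 h2
      obtain ⟨α, hα⟩ := cell_exists hn0 h1
      obtain ⟨β, hβ⟩ := cell_exists hn0 h2
      by_cases hab : α = β
      · subst hab
        have : |z.1 - z.2| ≤ 1 / (n:ℝ) := by
          have k1 := hα
          have k2 := hβ
          simp only [cell, Set.mem_Ioc, add_div] at k1 k2
          rw [abs_le]; constructor <;> linarith [k1.1, k1.2, k2.1, k2.2]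
        rw [if_pos this]
        have := graphon_sub_bd hg' hgD z.1 z.2
        linarith
      · have h3 : (g' - stepFn n D) z.1 z.2 = g' z.1 z.2 - g' (pt α) (pt β) := by
          simp only [Pi.sub_apply]
          rw [stepFn_apply D hα hβ, if_pos hab]
        have h4 : |g' z.1 z.2 - g' (pt α) (pt β)| < η := by
          have := huc' (a := (z.1, z.2)) (b := (pt α, pt β)) (by
            rw [Prod.dist_eq]
            exact max_lt (by simpa [Real.dist_eq] using hpt α _ hα)
              (by simpa [Real.dist_eq] using hpt β _ hβ))
          rw [Real.dist_eq] at this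
          exact this
        rw [h3]
        have : (0:ℝ) ≤ if |z.1 - z.2| ≤ 1 / (n:ℝ) then (1:ℝ) else 0 := by split_ifs <;> simp
        linarith
    · rw [integral_add (integrable_const η) i1]
      simp only [integral_const, probReal_univ, smul_eq_mul, one_mul]
      linarith
  have c2 : CutB (stepFn n (fun α β => D α β - X α β)) (2 * η + 1 / n) := by
    refine CutB_step hn0 _ ?_ _ ?_
    · intro α β
      have h1 := hC01 (E α).1 (E β).1
      have h2 := hX01 α β
      change |C (E α).1 (E β).1 - X α β| ≤ 1
      rw [abs_le]; constructor <;> linarith [h1.1, h1.2, h2.1, h2.2]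
    · intro U V hU hV
      let g : Fin p → Fin p → ZMod q → ℝ := fun a b z => meanq q (C a b) - χ a b z
      have hb := discrete_bound g ?_ ?_ (U ∘ E.symm) (V ∘ E.symm) (fun _ => hU _) (fun _ => hV _)
      rotate_left
      · intro a b z
        have h1 := (meanq_bd q (C a b) (hC01 a b)).2
        simp only [g]
        rcases hχ a b z with h | h <;> rw [h, abs_le] <;> constructor <;> linarith [h1.1, h1.2]
      · intro a b
        simp only [g, Finset.sum_sub_distrib, Finset.sum_const, Finset.card_univ, ZMod.card,
          nsmul_eq_mul, meanq, χ]
        field_simp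
        ring
      have hnc : (n:ℝ) = p * (q * q) := by rw [hn]; push_cast; ring
      rw [← hnc] at hb
      have e1 : ∑ x, ∑ y, g x.1 y.1 (dotq x.2 y.2) * ((U ∘ E.symm) x * (V ∘ E.symm) y) =
          ∑ α, ∑ β, g (E α).1 (E β).1 (dotq (E α).2 (E β).2) * (U α * V β) := by
        rw [← E.sum_comp]
        refine Finset.sum_congr rfl fun α _ => ?_
        rw [← E.sum_comp]
        simp
      rw [e1] at hb
      have hb' : |∑ α, ∑ β, g (E α).1 (E β).1 (dotq (E α).2 (E β).2) * (U α * V β)|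
          ≤ η * (n:ℝ) ^ 2 := by
        apply abs_le_of_sq_le_sq _ (by positivity)
        refine hb.trans ?_
        rw [mul_pow]
        gcongr
      have e2 : ∑ α, ∑ β, (D α β - X α β) * (U α * V β) =
          (∑ α, ∑ β, g (E α).1 (E β).1 (dotq (E α).2 (E β).2) * (U α * V β)) +
          ∑ α, ∑ β, (D α β - meanq q (D α β)) * (U α * V β) := by
        simp only [← Finset.sum_add_distrib]
        refine Finset.sum_congr rfl fun α _ => Finset.sum_congr rfl fun β _ => ?_
        simp only [g, D, X]
        ring
      have e3 : |∑ α, ∑ β, (D α β - meanq q (D α β)) * (U α * V β)| ≤ η * (n:ℝ) ^ 2 := by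
        refine (Finset.abs_sum_le_sum_abs _ _).trans ?_
        calc _ ≤ ∑ α : Fin n, ∑ β : Fin n, η := by
              refine Finset.sum_le_sum fun α _ => (Finset.abs_sum_le_sum_abs _ _).trans ?_
              refine Finset.sum_le_sum fun β _ => ?_
              rw [abs_mul, abs_mul]
              have m1 := (meanq_bd q (D α β) (hC01 _ _)).1.trans hq2
              have m2 := mul_le_one₀ (hU α) (abs_nonneg _) (hV β)
              calc _ ≤ η * 1 := mul_le_mul m1 m2 (by positivity) hη0.le
                _ = η := mul_one _
          _ = η * (n:ℝ) ^ 2 := by simp; ring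
      rw [e2]
      refine (abs_add_le _ _).trans ?_
      linarith
  have hsub : f - stepFn n X = (f - g') + ((g' - stepFn n D) + stepFn n (fun α β => D α β - X α β)) := by
    have : stepFn n (fun α β => D α β - X α β) = stepFn n D - stepFn n X := by
      ext x y
      simp only [Pi.sub_apply, stepFn, ← Finset.sum_sub_distrib]
      refine Finset.sum_congr rfl fun α _ => Finset.sum_congr rfl fun β _ => ?_
      split_ifs <;> simp
    rw [this]; abel
  have bX : BM (stepFn n (fun α β => D α β - X α β)) := by
    refine ⟨stepFn_meas _, 1, fun x y => ?_⟩
    have : stepFn n (fun α β => D α β - X α β) = stepFn n D - stepFn n X := by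
      ext x y
      simp only [Pi.sub_apply, stepFn, ← Finset.sum_sub_distrib]
      refine Finset.sum_congr rfl fun α _ => Finset.sum_congr rfl fun β _ => ?_
      split_ifs <;> simp
    rw [this]; exact graphon_sub_bd hgD hgX x y
  have b1 : BM (g' - stepFn n D) := ⟨graphon_sub_meas hg' hgD, 1, graphon_sub_bd hg' hgD⟩
  have b2 : BM ((g' - stepFn n D) + stepFn n (fun α β => D α β - X α β)) := by
    obtain ⟨m1, C1, h1⟩ := b1
    obtain ⟨m2, C2, h2⟩ := bX
    exact ⟨m1.add m2, C1 + C2, fun x y => (abs_add_le _ _).trans (add_le_add (h1 x y) (h2 x y))⟩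
  have b3 : BM (f - g') := ⟨graphon_sub_meas hf hg', 1, graphon_sub_bd hf hg'⟩
  have fin := CutB_add b3 b2 hfg' (CutB_add b1 bX c1 c2)
  rw [hsub]
  intro u v hu hv hu1 hv1
  refine (fin u v hu hv hu1 hv1).trans ?_
  have : ε = 8 * η := by rw [hη]; ring
  linarith

lemma nv_le_of_noIsolated {G : MG} (h : NoIsolated G) : G.nv ≤ 2 * G.ne := by
  have := Fintype.card_le_of_surjective (Sum.elim G.s G.t) (by
    intro v
    obtain ⟨e, he | he⟩ := h v
    · exact ⟨Sum.inl e, he⟩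
    · exact ⟨Sum.inr e, he⟩)
  simp at this
  omega

lemma finite_deg {R : Set MG} (hR : IsRepSet R) (m : ℕ) : {G ∈ R | G.ne = m}.Finite := by
  let T : ℕ → Set MG := fun n => Set.range
    (fun x : {x : (Fin m → Fin n) × (Fin m → Fin n) // ∀ e, x.1 e ≠ x.2 e} =>
      MG.mk n m x.1.1 x.1.2 x.2)
  have hT : (⋃ n ∈ Set.Iic (2 * m), T n).Finite :=
    (Set.finite_Iic _).biUnion fun n _ => Set.finite_range _
  refine hT.subset ?_
  rintro ⟨n, m', s, t, h⟩ ⟨hG, rfl⟩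
  have := nv_le_of_noIsolated (hR.1 _ hG)
  simp only [Set.mem_iUnion]
  exact ⟨n, this, ⟨⟨(s, t), h⟩, rfl⟩⟩

lemma fiber_tsum {R : Set MG} (hR : IsRepSet R) (w : MG → ℝ) (hw : ∀ G, G ∉ R → w G = 0) (m : ℕ) :
    ∑' b : (MG.ne ⁻¹' {m} : Set MG), w b = ∑ᶠ G ∈ {G ∈ R | G.ne = m}, w G := by
  rw [tsum_subtype, finsum_mem_def]
  have : (MG.ne ⁻¹' {m} : Set MG).indicator w = {G ∈ R | G.ne = m}.indicator w := by
    funext G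
    by_cases h1 : G.ne = m
    · by_cases h2 : G ∈ R
      · simp [Set.indicator, h1, h2]
      · simp [Set.indicator, h2, hw]
    · simp [Set.indicator, h1]
  rw [this, tsum_eq_finsum]
  exact (finite_deg hR m).subset Set.support_indicator_subset

lemma deg_hasSum {R : Set MG} (hR : IsRepSet R) (w : MG → ℝ) (hw : ∀ G, G ∉ R → w G = 0)
    (hs : Summable w) : HasSum (fun m => ∑ᶠ G ∈ {G ∈ R | G.ne = m}, w G) (∑' G, w G) := by
  have := hs.hasSum.tsum_fiberwise MG.ne
  simpa only [fiber_tsum hR w hw] using this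

lemma deg_summable {R : Set MG} (hR : IsRepSet R) (w : MG → ℝ) (hw : ∀ G, G ∉ R → w G = 0)
    (h0 : ∀ G, 0 ≤ w G) (hs : Summable (fun m => ∑ᶠ G ∈ {G ∈ R | G.ne = m}, w G)) :
    Summable w := by
  rw [summable_partition (s := fun m => MG.ne ⁻¹' {m}) h0 (fun G => ⟨G.ne, by simp, by
    intro y hy; exact hy.symm⟩)]
  refine ⟨fun m => ?_, ?_⟩
  · refine (summable_subtype_iff_indicator (f := w)).2 ?_
    refine summable_of_hasFiniteSupport ((finite_deg hR m).subset ?_)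
    intro G hG
    simp only [Function.mem_support, Set.indicator_apply_ne_zero] at hG
    refine ⟨by_contra fun h => hG.2 (hw G h), hG.1⟩
  · simpa only [fiber_tsum hR w hw] using hs

lemma MGIso.symm' {G H : MG} (h : MGIso G H) : MGIso H G := by
  obtain ⟨φ, h1, h2⟩ := h
  let V := Equiv.ofBijective _ h1
  let E := Equiv.ofBijective _ h2
  refine ⟨⟨V.symm, E.symm, ?_⟩, V.symm.bijective, E.symm.bijective⟩
  intro e
  obtain ⟨e, rfl⟩ := E.surjective e
  have := φ.compat e
  rw [finset_pair_iff] at this ⊢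
  have h3 := congrArg (Sym2.map V.symm) this
  simp only [Sym2.map_mk] at h3
  have h4 : ∀ v, V.symm (φ.vMap v) = v := fun v => V.symm_apply_apply v
  have h5 : E e = φ.eMap e := rfl
  rw [h4, h4] at h3
  rw [Equiv.symm_apply_apply, h5]
  exact h3.symm

lemma simple_of_iso {G H : MG} (h : MGIso G H) (hG : IsSimpleMG G) : IsSimpleMG H := by
  obtain ⟨φ, h1, h2⟩ := h.symm'
  intro e e' hee
  apply h2.1
  apply hG
  rw [φ.compat, φ.compat]
  rw [finset_pair_iff] at hee ⊢
  exact congrArg (Sym2.map φ.vMap) hee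

lemma ne_of_iso {G H : MG} (h : MGIso G H) : G.ne = H.ne := by
  obtain ⟨φ, h1, h2⟩ := h
  simpa using Fintype.card_of_bijective h2

lemma exists_rep {R : Set MG} (hR : IsRepSet R) : ∃ r : MG → MG, ∀ H ∈ R,
    r H ∈ R ∧ IsSimpleMG (r H) ∧ ∀ f : Kern, (∀ x y, f x y = f y x) →
      (∀ x y, f x y = 0 ∨ f x y = 1) → homDensity (r H) f = homDensity H f := by
  have : ∀ H : MG, ∃ K, H ∈ R → K ∈ R ∧ IsSimpleMG K ∧ ∀ f : Kern, (∀ x y, f x y = f y x) →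
      (∀ x y, f x y = 0 ∨ f x y = 1) → homDensity K f = homDensity H f := by
    intro H
    by_cases hH : H ∈ R
    · obtain ⟨K, ⟨hK, hi⟩, -⟩ := hR.2 (simpMG H) (simpMG_noIsolated H (hR.1 H hH))
      refine ⟨K, fun _ => ⟨hK, simple_of_iso hi (simpMG_simple H), fun f h1 h2 => ?_⟩⟩
      rw [← homDensity_iso hi f h1, homDensity_simpMG H f h1 h2]
    · exact ⟨H, fun h => absurd h hH⟩
  choose r hr using this
  exact ⟨r, hr⟩

lemma summable_mul_hom {w : MG → ℝ} (hs : Summable (fun G => |w G|)) {f : Kern} (hf : IsGraphon f)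
    (r : MG → MG) : Summable (fun G => w G * homDensity (r G) f) := by
  refine Summable.of_norm_bounded hs fun G => ?_
  rw [Real.norm_eq_abs, abs_mul]
  exact mul_le_of_le_one_right (abs_nonneg _) (abs_homDensity_le _ _ hf)

/-- Regrouping of coefficients along simplification. -/
lemma exists_B {R : Set MG} (hR : IsRepSet R) (A : MG → ℝ) (hA : ∀ G, G ∉ R → A G = 0)
    (hs : Summable (fun G => |A G|)) :
    ∃ B : MG → ℝ, (∀ G, G ∉ R → B G = 0) ∧ (∀ G, ¬ IsSimpleMG G → B G = 0) ∧
      Summable (fun G => |B G|) ∧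
      ∀ f, IsGraphon f → (∀ x y, f x y = 0 ∨ f x y = 1) →
        ∑' G, A G * homDensity G f = ∑' G, B G * homDensity G f := by
  obtain ⟨r, hr⟩ := exists_rep hR
  refine ⟨fun K => ∑' b : (r ⁻¹' {K} : Set MG), A b, ?_, ?_, ?_, ?_⟩
  · intro K hK
    have : ∀ b : (r ⁻¹' {K} : Set MG), A b = 0 := by
      rintro ⟨b, hb⟩
      refine hA _ fun h => hK ?_
      rw [← show r b = K from hb]; exact (hr b h).1
    simp [this]
  · intro K hK
    have : ∀ b : (r ⁻¹' {K} : Set MG), A b = 0 := by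
      rintro ⟨b, hb⟩
      refine hA _ fun h => hK ?_
      rw [← show r b = K from hb]; exact (hr b h).2.1
    simp [this]
  · refine Summable.of_norm_bounded (hs.hasSum.tsum_fiberwise r).summable fun K => ?_
    rw [Real.norm_eq_abs, abs_abs]
    exact norm_tsum_le_tsum_norm (f := fun b : (r ⁻¹' {K} : Set MG) => A b) (hs.subtype _)
  · intro f hf h01
    have e1 : ∀ G, A G * homDensity G f = A G * homDensity (r G) f := by
      intro G
      by_cases hG : G ∈ R
      · rw [(hr G hG).2.2 f hf.1.2 h01]
      · rw [hA G hG]; simp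
    simp only [e1]
    have := (summable_mul_hom hs hf r).hasSum.tsum_fiberwise r
    rw [← this.tsum_eq]
    refine tsum_congr fun K => ?_
    rw [← tsum_mul_right]
    refine tsum_congr fun b => ?_
    rw [show r b = K from b.2]

lemma eq_on_graphons {F : Kern → ℝ} (hcut : CutContOn F) (B : MG → ℝ)
    (hBs : ∀ G, ¬ IsSimpleMG G → B G = 0) (hs : Summable (fun G => |B G|))
    (h : ∀ f ∈ StepGraphons, (∀ x y, f x y = 0 ∨ f x y = 1) →
        F f = ∑' G, B G * homDensity G f) (f : Kern) (hf : IsGraphon f) :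
    F f = ∑' G, B G * homDensity G f := by
  have hn : ∀ n : ℕ, (0:ℝ) < 1 / (n + 1) := fun n => by positivity
  choose g hg h01 hc using fun n : ℕ => exists_step01 f hf (1 / ((n:ℝ) + 1)) (hn n)
  have t0 : Tendsto (fun n : ℕ => 1 / ((n:ℝ) + 1)) atTop (𝓝 0) :=
    tendsto_one_div_add_atTop_nhds_zero_nat
  have hgg : ∀ n, IsGraphon (g n) := fun n => (hg n).1
  have t1 : Tendsto (fun n => F (g n)) atTop (𝓝 (F f)) := by
    rw [Metric.tendsto_atTop]
    intro ε hε
    obtain ⟨δ, hδ, H⟩ := hcut f hf ε hε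
    obtain ⟨N, hN⟩ := (Metric.tendsto_atTop.1 t0) δ hδ
    refine ⟨N, fun n hnN => ?_⟩
    have h1 := hN n hnN
    rw [Real.dist_eq, sub_zero, abs_of_pos (hn n)] at h1
    rw [dist_comm, Real.dist_eq]
    exact H _ (hgg n) (lt_of_le_of_lt (cutNorm_le _ _ (hn n).le (hc n)) h1)
  have t2 : Tendsto (fun n => ∑' G, B G * homDensity G (g n)) atTop
      (𝓝 (∑' G, B G * homDensity G f)) := by
    refine tendsto_tsum_of_dominated_convergence hs ?_ ?_
    · intro G
      by_cases hG : IsSimpleMG G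
      · refine Tendsto.const_mul _ ?_
        rw [tendsto_iff_dist_tendsto_zero]
        refine squeeze_zero (fun _ => dist_nonneg) (g := fun n : ℕ => (G.ne : ℝ) * (1 / ((n:ℝ) + 1))) ?_ ?_
        · intro n
          rw [dist_comm, Real.dist_eq]
          exact counting G hG f (g n) hf (hgg n) _ (hc n)
        · simpa using t0.const_mul (G.ne : ℝ)
      · simp [hBs G hG]
    · refine Eventually.of_forall fun n G => ?_
      rw [Real.norm_eq_abs, abs_mul]
      exact mul_le_of_le_one_right (abs_nonneg _) (abs_homDensity_le _ _ (hgg n))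
  refine tendsto_nhds_unique t1 (t2.congr fun n => (h _ (hg n) (h01 n)).symm)

lemma smul_graphon {f : Kern} (hf : IsGraphon f) {s : ℝ} (hs : s ∈ Icc (0:ℝ) 1) :
    IsGraphon (s • f) := by
  refine ⟨⟨?_, fun x y => ?_⟩, fun x y => ?_⟩
  · exact hf.1.1.const_mul s
  · simp only [Pi.smul_apply, smul_eq_mul, hf.1.2 x y]
  · have := hf.2 x y
    simp only [Pi.smul_apply, smul_eq_mul]
    exact ⟨mul_nonneg hs.1 this.1, mul_le_one₀ hs.2 this.1 this.2⟩

lemma gD_deriv {F : Kern → ℝ} {f : Kern} (hf : IsGraphon f) (hne : ∃ x y, f x y ≠ 0)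
    (ψ : ℝ → ℝ) (hψ : AnalyticOnNhd ℝ ψ (Metric.ball 0 1))
    (hF : ∀ s ∈ Icc (0:ℝ) 1, s < 1 → F (s • f) = ψ s) (n : ℕ) :
    ∀ s ∈ Ico (0:ℝ) 1, gD Graphons F n (s • f) (fun _ => f) = iteratedDeriv n ψ s := by
  induction n with
  | zero => intro s hs; simp only [gD, iteratedDeriv_zero]; exact hF s ⟨hs.1, hs.2.le⟩ hs.2
  | succ n ih =>
    intro s hs
    obtain ⟨x, y, hxy⟩ := hne
    have hpos : 0 < f x y := lt_of_le_of_ne (hf.2 x y).1 (Ne.symm hxy)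
    have hsub : ∀ t : ℝ, s • f + t • f ∈ Graphons → 0 ≤ s + t := by
      intro t ht
      have h1 := (ht.2 x y).1
      simp only [Pi.add_apply, Pi.smul_apply, smul_eq_mul] at h1
      by_contra h
      have : (s + t) * f x y < 0 := mul_neg_of_neg_of_pos (not_le.1 h) hpos
      linarith
    have hmem : ∀ t : ℝ, 0 < t → t < 1 - s → t ∈ {t : ℝ | t ≠ 0 ∧ s • f + t • f ∈ Graphons} := by
      intro t h1 h2
      refine ⟨h1.ne', ?_⟩
      rw [← add_smul]
      exact smul_graphon hf ⟨by linarith [hs.1], by linarith⟩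
    have hlt : (0:ℝ) < 1 - s := by linarith [hs.2]
    have hnb : (𝓝[{t : ℝ | t ≠ 0 ∧ s • f + t • f ∈ Graphons}] (0:ℝ)).NeBot := by
      have h1 : (𝓝[Ioo (0:ℝ) (1 - s)] (0:ℝ)).NeBot := left_nhdsWithin_Ioo_neBot hlt
      exact h1.mono (nhdsWithin_mono _ fun t ht => hmem t ht.1 ht.2)
    have hd : HasDerivAt (iteratedDeriv n ψ) (iteratedDeriv (n + 1) ψ s) s := by
      rw [iteratedDeriv_succ]
      apply DifferentiableAt.hasDerivAt
      rw [iteratedDeriv_eq_iterate]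
      refine (hψ.iterated_deriv n s ?_).differentiableAt
      rw [Metric.mem_ball, Real.dist_eq, sub_zero, abs_of_nonneg hs.1]
      exact hs.2
    rw [hasDerivAt_iff_tendsto_slope_zero] at hd
    change limUnder _ _ = _
    refine Tendsto.limUnder_eq ?_
    have hd' := hd.mono_left (nhdsWithin_mono (0:ℝ)
      (fun t ht => ht.1 : {t : ℝ | t ≠ 0 ∧ s • f + t • f ∈ Graphons} ⊆ {0}ᶜ))
    refine hd'.congr' ?_
    have h1 : ∀ᶠ t in 𝓝[{t : ℝ | t ≠ 0 ∧ s • f + t • f ∈ Graphons}] (0:ℝ), t < 1 - s :=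
      mem_nhdsWithin_of_mem_nhds (Iio_mem_nhds hlt)
    filter_upwards [h1, self_mem_nhdsWithin] with t ht1 ht2
    have h0 := hsub t ht2.2
    rw [ih s hs, ← add_smul, ih (s + t) ⟨h0, by linarith⟩, smul_eq_mul]
    ring

lemma gD_coeff {F : Kern → ℝ} {f : Kern} (hf : IsGraphon f) (hne : ∃ x y, f x y ≠ 0)
    (c : ℕ → ℝ) (hc : Summable (fun n => |c n|))
    (hF : ∀ s ∈ Icc (0:ℝ) 1, HasSum (fun n => c n * s ^ n) (F (s • f))) (n : ℕ) :
    (1 / (Nat.factorial n : ℝ)) * gD Graphons F n 0 (fun _ => f) = c n := by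
  let p : FormalMultilinearSeries ℝ ℝ ℝ := FormalMultilinearSeries.ofScalars ℝ c
  have hr : (1 : ℝ≥0∞) ≤ p.radius := by
    have := p.le_radius_of_summable (r := 1) (by
      simpa [p, FormalMultilinearSeries.ofScalars_norm] using hc)
    simpa using this
  have hp := p.hasFPowerSeriesOnBall (lt_of_lt_of_le one_pos hr)
  have han : AnalyticOnNhd ℝ p.sum (Metric.ball 0 1) := by
    refine hp.analyticOnNhd.mono ?_
    rw [← Metric.eball_ofReal]
    refine Metric.eball_subset_eball ?_
    simpa using hr
  have h1 := gD_deriv (F := F) hf hne p.sum han (fun s hs _ => by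
    rw [← (hF s hs).tsum_eq]
    unfold FormalMultilinearSeries.sum
    refine tsum_congr fun n => ?_
    simp [p, mul_comm]) n 0 ⟨le_rfl, one_pos⟩
  rw [zero_smul] at h1
  rw [h1, iteratedDeriv_eq_iteratedFDeriv, ← hp.factorial_smul]
  have : (Nat.factorial n : ℝ) ≠ 0 := by exact_mod_cast n.factorial_ne_zero
  simp [p]
  field_simp

lemma equiv_of_exp {m n : ℕ} {α : Type*} (q : Fin m → α) (q' : Fin n → α)
    (h : ∑ e, Finsupp.single (q e) (1:ℕ) = ∑ e, Finsupp.single (q' e) (1:ℕ)) :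
    ∃ E : Fin m ≃ Fin n, ∀ e, q' (E e) = q e := by
  have hc : ∀ i, Nonempty ({e // q e = i} ≃ {e // q' e = i}) := by
    intro i
    have h1 := DFunLike.congr_fun h i
    simp only [Finsupp.finsetSum_apply, Finsupp.single_apply] at h1
    rw [← Finset.card_filter, ← Finset.card_filter] at h1
    rw [← Fintype.card_eq, Fintype.card_subtype, Fintype.card_subtype]
    exact h1
  let T := fun i => (hc i).some
  refine ⟨(Equiv.sigmaFiberEquiv q).symm.trans
    ((Equiv.sigmaCongrRight T).trans (Equiv.sigmaFiberEquiv q')), fun e => ?_⟩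
  exact (T (q e) ⟨e, rfl⟩).2

lemma iso_refl (G : MG) : MGIso G G :=
  ⟨⟨id, id, fun _ => rfl⟩, Function.bijective_id, Function.bijective_id⟩

lemma rep_eq {R : Set MG} (hR : IsRepSet R) {H G : MG} (hH : H ∈ R) (hG : G ∈ R)
    (h : MGIso H G) : H = G :=
  (hR.2 H (hR.1 H hH)).unique ⟨hH, iso_refl H⟩ ⟨hG, h⟩

lemma eq_of_exp {R : Set MG} (hR : IsRepSet R) {H G : MG} (hH : H ∈ R) (hG : G ∈ R)
    (hnv : H.nv ≤ G.nv) (φ : Fin H.nv → Fin G.nv)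
    (h : ∑ e, Finsupp.single (s(φ (H.s e), φ (H.t e))) (1:ℕ) =
      ∑ e, Finsupp.single (s(G.s e, G.t e)) (1:ℕ)) : H = G := by
  obtain ⟨E, hE⟩ := equiv_of_exp _ _ h
  have hsur : Function.Surjective φ := by
    intro v
    obtain ⟨e', he'⟩ := hR.1 G hG v
    obtain ⟨e, rfl⟩ := E.surjective e'
    have hv : v ∈ s(G.s (E e), G.t (E e)) := by
      rw [Sym2.mem_iff]
      rcases he' with h | h
      · exact Or.inl h.symm
      · exact Or.inr h.symm
    rw [hE, Sym2.mem_iff] at hv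
    rcases hv with h | h
    · exact ⟨_, h.symm⟩
    · exact ⟨_, h.symm⟩
  have hbij : Function.Bijective φ := by
    rw [Fintype.bijective_iff_surjective_and_card]
    refine ⟨hsur, le_antisymm (by simpa using hnv) (Fintype.card_le_of_surjective _ hsur)⟩
  refine rep_eq hR hH hG ⟨⟨φ, E, fun e => ?_⟩, hbij, E.bijective⟩
  rw [finset_pair_iff]
  exact hE e

lemma lin_indep {R : Set MG} (hR : IsRepSet R) (m : ℕ) (S : Finset MG)
    (hS : ∀ H ∈ S, H ∈ R ∧ H.ne = m) (b : MG → ℝ)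
    (h : ∀ p : ℕ, 2 ≤ p → ∀ c : Fin p → Fin p → ℝ, (∀ i j, c i j = c j i) →
      (∀ i j, c i j ∈ Ioc (0:ℝ) 1) → ∑ H ∈ S, b H * homDensity H (stepFn p c) = 0) :
    ∀ G ∈ S, b G = 0 := by
  by_contra hcon
  push Not at hcon
  have hne : (S.filter fun G => b G ≠ 0).Nonempty := by
    obtain ⟨G, hG, hb⟩ := hcon
    exact ⟨G, Finset.mem_filter.2 ⟨hG, hb⟩⟩
  obtain ⟨G, hG, hmax⟩ := Finset.exists_max_image _ MG.nv hne
  rw [Finset.mem_filter] at hG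
  obtain ⟨hGS, hb⟩ := hG
  have hGR := (hS G hGS).1
  have hmax' : ∀ H ∈ S, b H ≠ 0 → H.nv ≤ G.nv := fun H hH hbH =>
    hmax H (Finset.mem_filter.2 ⟨hH, hbH⟩)
  by_cases hne0 : G.ne = 0
  · have hnv0 : ∀ H ∈ S, H = G := by
      intro H hH
      have h1 : H.ne = 0 := by rw [(hS H hH).2, ← (hS G hGS).2, hne0]
      have h2 := nv_le_of_noIsolated (hR.1 H (hS H hH).1)
      have h3 := nv_le_of_noIsolated (hR.1 G hGR)
      obtain ⟨n, k, s, t, hl⟩ := H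
      obtain ⟨n', k', s', t', hl'⟩ := G
      simp only at h1 h2 h3 hne0
      subst h1 hne0
      have e1 : n = 0 := by omega
      have e2 : n' = 0 := by omega
      subst e1 e2
      congr 1 <;> exact Subsingleton.elim _ _
    have h1 := h 2 le_rfl (fun _ _ => 1) (by simp) (by simp)
    have hSG : S = {G} := by
      ext H
      rw [Finset.mem_singleton]
      exact ⟨hnv0 H, fun e => e ▸ hGS⟩
    rw [hSG, Finset.sum_singleton] at h1
    have ht : homDensity G (stepFn 2 fun _ _ => 1) = 1 := by
      unfold homDensity
      obtain ⟨n', k', s', t', hl'⟩ := G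
      simp only at hne0
      subst hne0
      simp
    rw [ht, mul_one] at h1
    exact hb h1
  have hp2 : 2 ≤ G.nv := by
    have hl := G.noLoop ⟨0, Nat.pos_of_ne_zero hne0⟩
    by_contra hlt
    apply hl
    apply Fin.ext
    have := (G.s ⟨0, Nat.pos_of_ne_zero hne0⟩).2
    have := (G.t ⟨0, Nat.pos_of_ne_zero hne0⟩).2
    omega
  have hp0 : (0:ℝ) < 1 / (G.nv:ℝ) := by
    have : (0:ℝ) < G.nv := by exact_mod_cast (by omega : 0 < G.nv)
    positivity
  let P : MvPolynomial (Sym2 (Fin G.nv)) ℝ := ∑ H ∈ S,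
    MvPolynomial.C (b H * (1 / (G.nv:ℝ)) ^ H.nv) * ∑ φ : Fin H.nv → Fin G.nv,
      if ∀ e, φ (H.s e) ≠ φ (H.t e) then
        MvPolynomial.monomial (∑ e, Finsupp.single (s(φ (H.s e), φ (H.t e))) (1:ℕ)) (1:ℝ) else 0
  have hP : P = 0 := by
    refine MvPolynomial.funext_set (fun _ => Ioc (0:ℝ) 1) (fun _ => Ioc_infinite one_pos) ?_
    intro x hx
    have h1 := h G.nv hp2 (fun i j => x s(i, j)) (fun i j => by rw [Sym2.eq_swap])
      (fun i j => hx _ (mem_univ _))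
    rw [map_zero, ← h1]
    simp only [P, map_sum, map_mul, MvPolynomial.eval_C]
    refine Finset.sum_congr rfl fun H hH => ?_
    rw [homDensity_stepFn H (by omega : 0 < G.nv), mul_assoc]
    congr 2
    refine Finset.sum_congr rfl fun φ _ => ?_
    split_ifs with hφ
    · rw [MvPolynomial.monomial_sum_one, map_prod]
      refine Finset.prod_congr rfl fun e _ => ?_
      rw [if_pos (hφ e)]
      exact MvPolynomial.eval_X (f := x) _
    · push Not at hφ
      obtain ⟨e, he⟩ := hφ
      rw [map_zero, eq_comm]
      exact Finset.prod_eq_zero (Finset.mem_univ e) (by simp [he])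
  have hcoef := congrArg (MvPolynomial.coeff (∑ e, Finsupp.single (s(G.s e, G.t e)) (1:ℕ))) hP
  simp only [P, MvPolynomial.coeff_sum, MvPolynomial.coeff_C_mul, MvPolynomial.coeff_zero] at hcoef
  rw [Finset.sum_eq_single_of_mem G hGS] at hcoef
  · have hpos : 0 < ∑ φ : Fin G.nv → Fin G.nv,
        MvPolynomial.coeff (∑ e, Finsupp.single (s(G.s e, G.t e)) (1:ℕ))
        (if ∀ e, φ (G.s e) ≠ φ (G.t e) then
        MvPolynomial.monomial (∑ e, Finsupp.single (s(φ (G.s e), φ (G.t e))) (1:ℕ)) (1:ℝ) else 0) := by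
      refine Finset.sum_pos' ?_ ⟨id, Finset.mem_univ _, ?_⟩
      · intro φ _
        split_ifs
        · rw [MvPolynomial.coeff_monomial]; split_ifs <;> simp
        · simp
      · simp only [id]
        rw [if_pos (fun e => G.noLoop e), MvPolynomial.coeff_monomial, if_pos rfl]
        exact one_pos
    have h2 : b G * (1 / (G.nv:ℝ)) ^ G.nv ≠ 0 := mul_ne_zero hb (pow_pos hp0 _).ne'
    exact (mul_ne_zero h2 hpos.ne') hcoef
  · intro H hH hHG
    by_cases hbH : b H = 0
    · rw [hbH]; simp
    · rw [mul_eq_zero]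
      right
      refine Finset.sum_eq_zero fun φ _ => ?_
      split_ifs
      · rw [MvPolynomial.coeff_monomial, if_neg]
        intro he
        exact hHG (eq_of_exp hR (hS H hH).1 hGR (hmax' H hH hbH) φ he)
      · simp

/-- Convergence of Taylor series. Let `F : W → ℝ` be a Gâteaux
smooth, cut-norm continuous class function, with Taylor coefficients `a_H` (indexed by
a system `R` of representatives of iso classes of multigraphs with no isolated
vertices, determined degreewise on step graphons).  If the Taylor polynomials of `F`
converge to `F` at every `{0,1}`-valued graphon, and the Taylor series is absolutely
convergent (`Σ_m Σ_{H ∈ ℋ_m} |a_H| t(H,1) < ∞`), then `a_H = 0` for every non-simple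
`H` and the Taylor series converges to `F` on all of `W`. -/
theorem stmt17 (F : Kern → ℝ) (hclass : IsClassFun F)
    (hsm : GSmooth Graphons F) (hcut : CutContOn F)
    (R : Set MG) (hR : IsRepSet R) (a : MG → ℝ)
    (ha : ∀ m : ℕ, ∀ f ∈ StepGraphons,
      (1 / (Nat.factorial m : ℝ)) * gD Graphons F m 0 (fun _ => f)
        = ∑ᶠ G ∈ {G ∈ R | G.ne = m}, a G * homDensity G f)
    (hconv01 : ∀ f ∈ Graphons, (∀ x y : ℝ, f x y = 0 ∨ f x y = 1) →
      Tendsto (fun N => ∑ m ∈ Finset.range (N + 1),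
          (1 / (Nat.factorial m : ℝ)) * gD Graphons F m 0 (fun _ => f))
        atTop (nhds (F f)))
    (habs : Summable (fun m : ℕ =>
      ∑ᶠ G ∈ {G ∈ R | G.ne = m}, |a G| * homDensity G (fun _ _ => 1))) :
    (∀ G ∈ R, ¬ IsSimpleMG G → a G = 0) ∧
    ∀ f ∈ Graphons,
      Tendsto (fun N => ∑ m ∈ Finset.range (N + 1),
          ∑ᶠ G ∈ {G ∈ R | G.ne = m}, a G * homDensity G f)
        atTop (nhds (F f)) := by
  classical
  have hA : ∀ G, G ∉ R → R.indicator a G = 0 := fun G hG => Set.indicator_of_notMem hG a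
  have hAR : ∀ G ∈ R, R.indicator a G = a G := fun G hG => Set.indicator_of_mem hG a
  have hAs : Summable (fun G => |R.indicator a G|) := by
    refine deg_summable hR _ (fun G hG => by rw [hA G hG, abs_zero]) (fun G => abs_nonneg _) ?_
    refine habs.congr fun m => ?_
    refine finsum_mem_congr rfl fun G hG => ?_
    rw [homDensity_one, mul_one, hAR G hG.1]
  have hsum : ∀ (w : MG → ℝ), (∀ G, G ∉ R → w G = 0) → Summable (fun G => |w G|) →
      ∀ f, IsGraphon f → HasSum (fun m => ∑ᶠ G ∈ {G ∈ R | G.ne = m}, w G * homDensity G f)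
        (∑' G, w G * homDensity G f) := fun w hw hs f hf =>
    deg_hasSum hR (fun G => w G * homDensity G f) (fun G hG => by rw [hw G hG, zero_mul])
      (summable_mul_hom hs hf id)
  have hAeq : ∀ m f, ∑ᶠ G ∈ {G ∈ R | G.ne = m}, R.indicator a G * homDensity G f
      = ∑ᶠ G ∈ {G ∈ R | G.ne = m}, a G * homDensity G f := fun m f =>
    finsum_mem_congr rfl fun G hG => by rw [hAR G hG.1]
  have hlim : ∀ f, IsGraphon f → Tendsto (fun N => ∑ m ∈ Finset.range (N + 1),
          ∑ᶠ G ∈ {G ∈ R | G.ne = m}, a G * homDensity G f)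
        atTop (nhds (∑' G, R.indicator a G * homDensity G f)) := by
    intro f hf
    have h1 := (hsum _ hA hAs f hf).tendsto_sum_nat
    simp only [hAeq] at h1
    exact h1.comp (tendsto_add_atTop_nat 1)
  obtain ⟨B, hB, hBs, hBsum, hAB⟩ := exists_B hR _ hA hAs
  have hFB : ∀ f, IsGraphon f → F f = ∑' G, B G * homDensity G f := by
    refine eq_on_graphons hcut B hBs hBsum ?_
    intro f hf h01
    rw [← hAB f hf.1 h01]
    refine tendsto_nhds_unique (hconv01 f hf.1 h01) ?_
    have h1 := hlim f hf.1
    refine h1.congr fun N => ?_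
    exact Finset.sum_congr rfl fun m _ => (ha m f hf).symm
  have hcoef : ∀ m : ℕ, ∀ f ∈ StepGraphons, (∃ x y, f x y ≠ 0) →
      ∑ᶠ G ∈ {G ∈ R | G.ne = m}, a G * homDensity G f
        = ∑ᶠ G ∈ {G ∈ R | G.ne = m}, B G * homDensity G f := by
    intro m f hf hne
    rw [← ha m f hf]
    refine gD_coeff hf.1 hne (fun n => ∑ᶠ G ∈ {G ∈ R | G.ne = n}, B G * homDensity G f) ?_ ?_ m
    · exact (hsum B hB hBsum f hf.1).summable.abs
    · intro s hs
      have h1 := hsum B hB hBsum (s • f) (smul_graphon hf.1 hs)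
      rw [← hFB _ (smul_graphon hf.1 hs)] at h1
      convert h1 using 1
      funext n
      rw [finsum_mem_eq_finite_toFinset_sum _ (finite_deg hR n),
        finsum_mem_eq_finite_toFinset_sum _ (finite_deg hR n), Finset.sum_mul]
      refine Finset.sum_congr rfl fun G hG => ?_
      have hG' : G ∈ {G ∈ R | G.ne = n} := by simpa using hG
      rw [homDensity_smul, show G.ne = n from hG'.2]
      ring
  have haB : ∀ G ∈ R, a G = B G := by
    intro G hG
    have h1 := lin_indep hR G.ne (finite_deg hR G.ne).toFinset
      (fun H hH => by simpa using hH) (fun H => a H - B H) ?_ G (by simpa using hG)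
    · exact sub_eq_zero.1 h1
    intro p hp c hcs hc
    have hstep : stepFn p c ∈ StepGraphons :=
      ⟨stepFn_graphon c hcs fun i j => ⟨(hc i j).1.le, (hc i j).2⟩, p, c, rfl⟩
    have hne : ∃ x y, stepFn p c x y ≠ 0 := by
      have hmem : ∀ i : Fin p, (((i : ℕ) : ℝ) + 1) / (p : ℝ) ∈ cell p i := by
        intro i
        have : (0:ℝ) < p := by exact_mod_cast (by omega : 0 < p)
        refine ⟨?_, le_rfl⟩
        gcongr
        linarith
      have hval := stepFn_apply c (hmem ⟨0, by omega⟩) (hmem ⟨1, by omega⟩)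
      rw [if_pos (by simp)] at hval
      exact ⟨_, _, by rw [hval]; exact (hc _ _).1.ne'⟩
    have h2 := hcoef G.ne _ hstep hne
    rw [finsum_mem_eq_finite_toFinset_sum _ (finite_deg hR G.ne),
      finsum_mem_eq_finite_toFinset_sum _ (finite_deg hR G.ne)] at h2
    simp only [sub_mul, Finset.sum_sub_distrib]
    rw [h2, sub_self]
  refine ⟨fun G hG hns => by rw [haB G hG, hBs G hns], fun f hf => ?_⟩
  have h1 := hlim f hf
  have h2 : ∑' G, R.indicator a G * homDensity G f = F f := by
    rw [hFB f hf]
    refine tsum_congr fun G => ?_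
    by_cases hG : G ∈ R
    · rw [hAR G hG, haB G hG]
    · rw [hA G hG, hB G hG]
  rwa [h2] at h1
end

section
/- Fix an integer k ≥ 0 and a vector 𝐱 = (𝐱₁,…,𝐱_k) ∈ [0,1]^k with pairwise distinct entries. (a) For every n ≥ 0, the partially labelled homomorphism densities t_𝐱(H,−), as H ranges over isomorphism classes of k-labelled multigraphs with n edges and no unlabelled isolated vertices, are linearly independent as functions on W. (b) Consequently, if a formal series Σ_{n≥0} Σ_{H∈ℋ_{n,k}} a_H·t_𝐱(H,−) has positive radius of convergence (limsup_n (Σ_{H∈ℋ_{n,k}} |a_H|)^{1/n} < ∞), then the coefficients a_H are uniquely determined by the function it defines; more precisely, they can be recovered from the Gâteaux derivatives d^nF(0; f, …, f) for f ranging over step graphons W_𝐩. -/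
open MeasureTheory Filter Set Topology
open scoped BigOperators Classical ENNReal

/-- The step kernel attached to a finite partition `φ`. -/
def stepK {T : Type} (φ : ℝ → T) (z : Sym2 T → ℝ) : Kern := fun u v => z s(φ u, φ v)

lemma stepK_graphon {T : Type} [Fintype T] [MeasurableSpace T] [DiscreteMeasurableSpace T]
    (φ : ℝ → T) (hφ : Measurable φ)
    (z : Sym2 T → ℝ) (hz : ∀ q, z q ∈ Set.Icc (0:ℝ) 1) : stepK φ z ∈ Graphons := by
  refine ⟨⟨?_, ?_⟩, fun u v => hz _⟩
  · have h1 : Measurable (fun q : T × T => z s(q.1, q.2)) := measurable_of_countable _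
    exact h1.comp ((hφ.comp measurable_fst).prodMk (hφ.comp measurable_snd))
  · intro u v
    simp only [stepK, Sym2.eq_swap]

instance : IsProbabilityMeasure μ01 := ⟨by simp [μ01]⟩

lemma assign_meas {k : ℕ} (H : LMG k) (x : Fin k → ℝ) : Measurable (fun y => H.assign x y) := by
  refine measurable_pi_lambda _ fun v => ?_
  unfold LMG.assign
  by_cases h : ∃ a, H.lab a = v
  · simp only [h, dif_pos]; exact measurable_const
  · simp only [h, dif_neg, not_false_eq_true]; exact measurable_pi_apply v

lemma assign_lab {k : ℕ} (H : LMG k) (x : Fin k → ℝ) (y : Fin H.G.nv → ℝ) (a : Fin k) :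
    H.assign x y (H.lab a) = x a := by
  unfold LMG.assign
  have h : ∃ b, H.lab b = H.lab a := ⟨a, rfl⟩
  rw [dif_pos h, H.inj h.choose_spec]

/-- Weight of a vertex map. -/
noncomputable def wt {k : ℕ} {T : Type} (H : LMG k) (x : Fin k → ℝ) (φ : ℝ → T) (ψ : Fin H.G.nv → T) : ℝ :=
  (Measure.pi fun _ : Fin H.G.nv => μ01).real {y | (fun v => φ (H.assign x y v)) = ψ}

lemma lhom_step {k : ℕ} {T : Type} [Fintype T] [MeasurableSpace T] [DiscreteMeasurableSpace T]
    (H : LMG k) (x : Fin k → ℝ) (φ : ℝ → T) (hφ : Measurable φ) (z : Sym2 T → ℝ) :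
    lhom H x (stepK φ z) = ∑ ψ : Fin H.G.nv → T,
      wt H x φ ψ * ∏ e, z s(ψ (H.G.s e), ψ (H.G.t e)) := by
  have hm : ∀ ψ : Fin H.G.nv → T,
      MeasurableSet {y | (fun v => φ (H.assign x y v)) = ψ} := by
    intro ψ
    have : {y | (fun v => φ (H.assign x y v)) = ψ} =
        ⋂ v, (fun y => φ (H.assign x y v)) ⁻¹' {ψ v} := by
      ext y; simp [funext_iff]
    rw [this]
    refine MeasurableSet.iInter fun v => ?_
    exact (hφ.comp ((measurable_pi_apply v).comp (assign_meas H x))) (measurableSet_singleton _)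
  unfold lhom
  have key : ∀ y : Fin H.G.nv → ℝ,
      ∏ e, stepK φ z (H.assign x y (H.G.s e)) (H.assign x y (H.G.t e)) =
      ∑ ψ : Fin H.G.nv → T, Set.indicator {y | (fun v => φ (H.assign x y v)) = ψ}
        (fun _ => ∏ e, z s(ψ (H.G.s e), ψ (H.G.t e))) y := by
    intro y
    rw [Finset.sum_eq_single (fun v => φ (H.assign x y v))]
    · rw [Set.indicator_of_mem (by simp)]; rfl
    · intro ψ _ h
      exact Set.indicator_of_notMem (fun h' => h h'.symm) _
    · simp
  simp_rw [key]
  rw [integral_finsetSum]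
  · refine Finset.sum_congr rfl fun ψ _ => ?_
    rw [integral_indicator_const _ (hm ψ)]
    rfl
  · intro ψ _
    exact (integrable_const _).indicator (hm ψ)

lemma wt_lab {k : ℕ} {T : Type} (H : LMG k) (x : Fin k → ℝ) (φ : ℝ → T) (ψ : Fin H.G.nv → T)
    (h : wt H x φ ψ ≠ 0) (a : Fin k) : ψ (H.lab a) = φ (x a) := by
  by_contra hne
  apply h
  have : {y | (fun v => φ (H.assign x y v)) = ψ} = ∅ := by
    ext y
    simp only [Set.mem_ofPred_eq, Set.mem_empty_iff_false, iff_false]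
    intro h'
    apply hne
    have h2 := congrFun h' (H.lab a)
    simp only [assign_lab] at h2
    exact h2.symm
  rw [wt, this]; simp

lemma wt_nonneg {k : ℕ} {T : Type} (H : LMG k) (x : Fin k → ℝ) (φ : ℝ → T)
    (ψ : Fin H.G.nv → T) : 0 ≤ wt H x φ ψ := measureReal_nonneg

lemma wt_pos {k : ℕ} {T : Type} (H : LMG k) (x : Fin k → ℝ) (φ : ℝ → T)
    (ψ : Fin H.G.nv → T)
    (h1 : ∀ a, φ (x a) = ψ (H.lab a)) (h2 : ∀ v, μ01 (φ ⁻¹' {ψ v}) ≠ 0) :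
    0 < wt H x φ ψ := by
  unfold wt
  rw [measureReal_def]
  refine ENNReal.toReal_pos ?_ (measure_ne_top _ _)
  intro h0
  have hsub : Set.univ.pi (fun v => φ ⁻¹' {ψ v}) ⊆
      {y | (fun v => φ (H.assign x y v)) = ψ} := by
    intro y hy
    simp only [Set.mem_ofPred_eq]
    funext v
    by_cases h : ∃ a, H.lab a = v
    · obtain ⟨a, rfl⟩ := h
      rw [assign_lab, h1]
    · have : H.assign x y v = y v := by simp [LMG.assign, h]
      rw [this]
      exact hy v trivial
  have := measure_mono_null hsub h0
  rw [Measure.pi_pi, Finset.prod_eq_zero_iff] at this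
  obtain ⟨v, _, hv⟩ := this
  exact h2 v hv

/-- A partition suitable for extracting coefficients. -/
lemma exists_part {k : ℕ} (H : LMG k) (x : Fin k → ℝ) (hx : Function.Injective x) :
    ∃ φ : ℝ → Fin (H.G.nv + 1), Measurable φ ∧ (∀ a, φ (x a) = (H.lab a).castSucc) ∧
      ∀ v : Fin H.G.nv, μ01 (φ ⁻¹' {v.castSucc}) ≠ 0 := by
  let ψ : ℝ → Fin (H.G.nv + 1) := fun u => Fin.ofNat (H.G.nv + 1) ⌊u * H.G.nv⌋₊
  have hψ : Measurable ψ :=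
    (measurable_of_countable (Fin.ofNat (H.G.nv + 1))).comp
      (Nat.measurable_floor.comp (measurable_id.mul_const _))
  let φ : ℝ → Fin (H.G.nv + 1) := fun u =>
    if h : ∃ a, x a = u then (H.lab h.choose).castSucc else ψ u
  have hfin : (Set.range x).Finite := Set.finite_range x
  have hoff : ∀ u, u ∉ Set.range x → φ u = ψ u := by
    intro u hu
    have : ¬ ∃ a, x a = u := hu
    simp [φ, this]
  refine ⟨φ, ?_, ?_, ?_⟩
  · refine hψ.measurable_of_countable_ne ?_
    refine hfin.countable.mono ?_
    intro u hu
    by_contra h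
    exact hu (hoff u h).symm
  · intro a
    have h : ∃ b, x b = x a := ⟨a, rfl⟩
    simp only [φ]
    rw [dif_pos h, hx h.choose_spec]
  · intro v h0
    have hnv : 0 < H.G.nv := v.pos
    have hnv' : (0:ℝ) < H.G.nv := by exact_mod_cast hnv
    have hsub : Set.Ico ((v:ℝ) / H.G.nv) (((v:ℝ) + 1) / H.G.nv) ⊆
        (φ ⁻¹' {v.castSucc}) ∪ Set.range x := by
      intro u hu
      by_cases hr : u ∈ Set.range x
      · exact Or.inr hr
      left
      simp only [Set.mem_preimage, Set.mem_singleton_iff]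
      rw [hoff u hr]
      have h1 : ⌊u * H.G.nv⌋₊ = (v:ℕ) := by
        rw [Nat.floor_eq_iff (by
          have := hu.1
          have h3 : 0 ≤ (v:ℝ) / H.G.nv := by positivity
          have : 0 ≤ u := h3.trans this
          positivity)]
        exact ⟨(div_le_iff₀ hnv').1 hu.1, (lt_div_iff₀ hnv').1 hu.2⟩
      simp only [ψ, h1]
      apply Fin.ext
      simp [Fin.ofNat, Nat.mod_eq_of_lt (Nat.lt_succ_of_lt v.2)]
    have hr0 : μ01 (Set.range x) = 0 := hfin.measure_zero _
    have h2 := measure_mono_null hsub (measure_union_null h0 hr0)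
    rw [Measure.restrict_apply measurableSet_Ico] at h2
    have hin : Set.Ico ((v:ℝ) / H.G.nv) (((v:ℝ) + 1) / H.G.nv) ⊆ Set.Icc 0 1 := by
      intro u hu
      refine ⟨le_trans (by positivity) hu.1, hu.2.le.trans ?_⟩
      rw [div_le_one hnv']
      have := v.2
      exact_mod_cast this
    rw [Set.inter_eq_left.2 hin, Real.volume_Ico] at h2
    simp only [ENNReal.ofReal_eq_zero] at h2
    have : (v:ℝ) / H.G.nv < ((v:ℝ) + 1) / H.G.nv := by gcongr; linarith
    linarith

lemma equiv_of_sum_single {α β S : Type} [Fintype α] [Fintype β] (F : α → S) (G : β → S)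
    (h : ∑ a, Finsupp.single (F a) 1 = (∑ b, Finsupp.single (G b) 1 : S →₀ ℕ)) :
    ∃ σ : α ≃ β, ∀ a, G (σ a) = F a := by
  have hc : ∀ c, Nonempty ({a // F a = c} ≃ {b // G b = c}) := by
    intro c
    have := DFunLike.congr_fun h c
    simp only [Finsupp.finsetSum_apply, Finsupp.single_apply, Finset.sum_boole] at this
    refine ⟨Fintype.equivOfCardEq ?_⟩
    rw [Fintype.card_subtype, Fintype.card_subtype]
    exact_mod_cast this
  refine ⟨Equiv.ofFiberEquiv fun c => (hc c).some, fun a => ?_⟩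
  exact Equiv.ofFiberEquiv_map _ a

/-- Edge monomial. -/
noncomputable def emon {k : ℕ} {T : Type} (H : LMG k) (ψ : Fin H.G.nv → T) : Sym2 T →₀ ℕ :=
  ∑ e, Finsupp.single s(ψ (H.G.s e), ψ (H.G.t e)) 1

lemma sym2_finset {T : Type} [DecidableEq T] {a b c d : T} (h : s(a, b) = s(c, d)) :
    ({a, b} : Finset T) = {c, d} := by
  rcases Sym2.eq_iff.1 h with ⟨rfl, rfl⟩ | ⟨rfl, rfl⟩
  · rfl
  · exact Finset.pair_comm _ _

lemma iso_of_emon {k : ℕ} (H H₀ : LMG k) (hI : H₀.NoUnlabIsolated)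
    (hnv : H.G.nv ≤ H₀.G.nv) (ψ : Fin H.G.nv → Fin (H₀.G.nv + 1))
    (hl : ∀ a, ψ (H.lab a) = (H₀.lab a).castSucc)
    (hm : emon H ψ = emon H₀ Fin.castSucc) : LMGIso H H₀ := by
  obtain ⟨σ, hσ⟩ := equiv_of_sum_single _ _ hm
  -- every vertex of `H₀` is hit
  have hsurj : ∀ v : Fin H₀.G.nv, ∃ u, ψ u = v.castSucc := by
    intro v
    rcases hI v with ⟨e, he⟩ | ⟨a, ha⟩
    · have h1 := hσ (σ.symm e)
      rw [Equiv.apply_symm_apply] at h1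
      have h2 : v.castSucc ∈ s((H₀.G.s e).castSucc, (H₀.G.t e).castSucc) := by
        rcases he with rfl | rfl <;> simp
      rw [h1, Sym2.mem_iff] at h2
      rcases h2 with h | h
      · exact ⟨_, h.symm⟩
      · exact ⟨_, h.symm⟩
    · exact ⟨H.lab a, by rw [hl, ha]⟩
  choose g hg using hsurj
  have ginj : Function.Injective g := by
    intro v w h
    have := hg v
    rw [h, hg w] at this
    exact (Fin.castSucc_injective _ this).symm
  have gbij : Function.Bijective g := by
    rw [Fintype.bijective_iff_injective_and_card]
    refine ⟨ginj, ?_⟩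
    have := Fintype.card_le_of_injective g ginj
    simp only [Fintype.card_fin] at this ⊢
    omega
  let E := Equiv.ofBijective g gbij
  have hE : ∀ u, (E.symm u).castSucc = ψ u := by
    intro u
    rw [← hg]
    exact congrArg ψ (E.apply_symm_apply u)
  refine ⟨E.symm, σ, ?_, ?_⟩
  · intro e
    apply sym2_finset
    have := hσ e
    rw [← hE, ← hE] at this
    exact Sym2.map.injective (Fin.castSucc_injective _) this
  · intro a
    apply Fin.castSucc_injective
    rw [hE, hl]

lemma partA {k : ℕ} (x : Fin k → ℝ) (hx : Function.Injective x) {ι : Type} (s : Finset ι)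
    (H : ι → LMG k) (hI : ∀ i ∈ s, (H i).NoUnlabIsolated)
    (hiso : ∀ i ∈ s, ∀ j ∈ s, i ≠ j → ¬ LMGIso (H i) (H j)) (c : ι → ℝ)
    (h : ∀ f ∈ Graphons, ∑ i ∈ s, c i * lhom (H i) x f = 0) : ∀ i ∈ s, c i = 0 := by
  by_contra hcon
  push Not at hcon
  obtain ⟨i₁, hi₁, hc₁⟩ := hcon
  obtain ⟨i₀, hi₀, hmax⟩ := Finset.exists_max_image (s.filter fun i => c i ≠ 0)
    (fun i => (H i).G.nv) ⟨i₁, by simp [hi₁, hc₁]⟩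
  rw [Finset.mem_filter] at hi₀
  obtain ⟨hi₀, hc₀⟩ := hi₀
  obtain ⟨φ, hφ, hφx, hφpos⟩ := exists_part (H i₀) x hx
  let P : MvPolynomial (Sym2 (Fin ((H i₀).G.nv + 1))) ℝ :=
    ∑ i ∈ s, ∑ ψ : Fin (H i).G.nv → Fin ((H i₀).G.nv + 1),
      MvPolynomial.monomial (emon (H i) ψ) (c i * wt (H i) x φ ψ)
  have hP : P = 0 := by
    refine MvPolynomial.funext_set (fun _ => Set.Icc (0:ℝ) 1)
      (fun _ => Set.Icc_infinite one_pos) ?_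
    intro z hz
    have := h _ (stepK_graphon φ hφ z (fun q => hz q trivial))
    simp only [map_zero]
    rw [← this]
    simp only [P, map_sum]
    refine Finset.sum_congr rfl fun i _ => ?_
    rw [lhom_step _ _ _ hφ, Finset.mul_sum]
    refine Finset.sum_congr rfl fun ψ _ => ?_
    rw [MvPolynomial.eval_monomial, mul_assoc]
    congr 2
    unfold emon
    rw [← Finsupp.prod_finsetSum_index (by simp) (by intros; rw [pow_add])]
    simp
  have hco := congrArg (MvPolynomial.coeff (emon (H i₀) Fin.castSucc)) hP
  simp only [P, MvPolynomial.coeff_sum, MvPolynomial.coeff_monomial,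
    MvPolynomial.coeff_zero] at hco
  rw [Finset.sum_eq_single_of_mem i₀ hi₀] at hco
  · have h3 : c i₀ * ∑ ψ : Fin (H i₀).G.nv → Fin ((H i₀).G.nv + 1),
        (if emon (H i₀) ψ = emon (H i₀) Fin.castSucc then wt (H i₀) x φ ψ else 0) = 0 := by
      refine Eq.trans ?_ hco
      rw [Finset.mul_sum]
      refine Finset.sum_congr rfl fun ψ _ => ?_
      split_ifs <;> simp
    rcases mul_eq_zero.1 h3 with h4 | h4
    · exact hc₀ h4
    · rw [Finset.sum_eq_zero_iff_of_nonneg] at h4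
      · have h5 := h4 Fin.castSucc (Finset.mem_univ _)
        rw [if_pos rfl] at h5
        have := wt_pos (H i₀) x φ Fin.castSucc hφx hφpos
        exact this.ne' h5
      · intro ψ _
        split_ifs
        · exact wt_nonneg _ _ _ _
        · exact le_rfl
  · intro j hj hne
    refine Finset.sum_eq_zero fun ψ _ => ?_
    split_ifs with he
    · by_contra h0
      have hcj : c j ≠ 0 := left_ne_zero_of_mul h0
      have hw := right_ne_zero_of_mul h0
      refine hiso j hj i₀ hi₀ hne (iso_of_emon (H j) (H i₀) (hI _ hi₀)
        (hmax j (by simp [hj, hcj])) ψ ?_ he)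
      intro a
      rw [wt_lab _ _ _ _ hw, hφx]
    · rfl

lemma lhom_smul {k : ℕ} (H : LMG k) (x : Fin k → ℝ) (f : Kern) (ε : ℝ) :
    lhom H x (ε • f) = ε ^ H.G.ne * lhom H x f := by
  unfold lhom
  rw [← integral_const_mul]
  congr 1
  funext y
  simp [Finset.prod_mul_distrib]

lemma lhom_abs_le {k : ℕ} (H : LMG k) (x : Fin k → ℝ) (f : Kern) (hf : f ∈ Graphons) :
    |lhom H x f| ≤ 1 := by
  unfold lhom
  have := norm_integral_le_of_norm_le_const (μ := Measure.pi fun _ : Fin H.G.nv => μ01)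
    (f := fun y => ∏ e : Fin H.G.ne, f (H.assign x y (H.G.s e)) (H.assign x y (H.G.t e)))
    (C := 1) (Filter.Eventually.of_forall fun y => by
      rw [Real.norm_eq_abs, Finset.abs_prod]
      refine Finset.prod_le_one (fun _ _ => abs_nonneg _) fun e _ => ?_
      have := hf.2 (H.assign x y (H.G.s e)) (H.assign x y (H.G.t e))
      rw [abs_of_nonneg this.1]
      exact this.2)
  simpa using this

lemma smul_graphon_s18 {f : Kern} (hf : f ∈ Graphons) {ε : ℝ} (h0 : 0 ≤ ε) (h1 : ε ≤ 1) :
    ε • f ∈ Graphons := by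
  refine ⟨⟨?_, ?_⟩, ?_⟩
  · exact hf.1.1.const_smul ε
  · intro u v
    simp [hf.1.2 u v]
  · intro u v
    have := hf.2 u v
    exact ⟨mul_nonneg h0 this.1, mul_le_one₀ h1 this.1 this.2⟩

lemma lmgIso_refl {k : ℕ} (H : LMG k) : LMGIso H H :=
  ⟨Equiv.refl _, Equiv.refl _, by simp, by simp⟩

lemma nv_le {k : ℕ} (H : LMG k) (h : H.NoUnlabIsolated) : H.G.nv ≤ k + 2 * H.G.ne := by
  let g : Fin k ⊕ (Fin H.G.ne ⊕ Fin H.G.ne) → Fin H.G.nv :=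
    Sum.elim H.lab (Sum.elim H.G.s H.G.t)
  have hg : Function.Surjective g := by
    intro v
    rcases h v with ⟨e, he | he⟩ | ⟨a, ha⟩
    · exact ⟨Sum.inr (Sum.inl e), he⟩
    · exact ⟨Sum.inr (Sum.inr e), he⟩
    · exact ⟨Sum.inl a, ha⟩
  have := Fintype.card_le_of_surjective g hg
  simp at this
  omega

lemma finite_lmg (k n N : ℕ) : {H : LMG k | H.G.ne = n ∧ H.G.nv ≤ N}.Finite := by
  let S := Σ m : Fin (N + 1), (Fin n → Fin m) × (Fin n → Fin m) × (Fin k → Fin m)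
  let F : S → Option (LMG k) := fun q =>
    if h : (∀ e, q.2.1 e ≠ q.2.2.1 e) ∧ Function.Injective q.2.2.2 then
      some ⟨⟨q.1, n, q.2.1, q.2.2.1, h.1⟩, q.2.2.2, h.2⟩ else none
  have hfin : (Set.range F).Finite := Set.finite_range F
  refine (hfin.preimage (f := some) (Option.some_injective _).injOn).subset ?_
  rintro ⟨⟨nv, ne, s, t, hl⟩, lab, inj⟩ ⟨h1, h2⟩
  simp only at h1 h2
  subst h1
  refine ⟨⟨⟨nv, by omega⟩, s, t, lab⟩, ?_⟩
  simp only [F]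
  rw [dif_pos ⟨hl, inj⟩]

lemma coeff_zero_of_series (b : ℕ → ℝ) (C M : ℝ) (hM : 0 ≤ M)
    (hb : ∀ n, |b n| ≤ C * M ^ n)
    (h : ∀ ε : ℝ, 0 ≤ ε → ε * (M + 1) < 1 → ∑' n, ε ^ n * b n = 0) : ∀ n, b n = 0 := by
  have hs : ∀ z : ℝ, |z| * (M + 1) < 1 → Summable fun n => z ^ n * b n := by
    intro z hz
    refine Summable.of_norm_bounded (g := fun n => C * (|z| * M) ^ n) ?_ ?_
    · refine (summable_geometric_of_lt_one (by positivity) ?_).mul_left C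
      nlinarith [abs_nonneg z]
    · intro n
      rw [Real.norm_eq_abs, abs_mul, abs_pow, mul_pow]
      have := mul_le_mul_of_nonneg_left (hb n) (pow_nonneg (abs_nonneg z) n)
      linarith
  have hd : (0:ℝ) < 1 / (M + 1) := by positivity
  let p : FormalMultilinearSeries ℝ ℝ ℝ := FormalMultilinearSeries.ofScalars ℝ b
  have hp : HasFPowerSeriesAt (fun z : ℝ => ∑' n, z ^ n * b n) p 0 := by
    rw [hasFPowerSeriesAt_iff]
    filter_upwards [Metric.ball_mem_nhds (0:ℝ) hd] with z hz
    rw [Metric.mem_ball, dist_zero_right, Real.norm_eq_abs, lt_div_iff₀ (by positivity)] at hz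
    simpa [p] using (hs z hz).hasSum
  have hev : ∀ᶠ z in 𝓝 (0:ℝ), (fun z : ℝ => ∑' n, z ^ n * b n) z = 0 := by
    refine hp.analyticAt.frequently_zero_iff_eventually_zero.1 ?_
    have h1 : ∀ᶠ z in 𝓝[>] (0:ℝ), (fun z : ℝ => ∑' n, z ^ n * b n) z = 0 := by
      filter_upwards [Ioo_mem_nhdsGT hd] with z hz
      exact h z hz.1.le ((lt_div_iff₀ (by positivity)).1 hz.2)
    exact h1.frequently.filter_mono (nhdsWithin_mono _ fun z hz => ne_of_gt hz)
  have hp0 : p = 0 := (hp.congr hev).eq_zero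
  intro n
  have h1 : p.coeff n = b n := by simp [p]
  rw [← h1, hp0]
  simp [FormalMultilinearSeries.coeff]

/-- Fix `k ≥ 0` and `𝐱 ∈ [0,1]^k` with pairwise distinct entries.
(a) For each `n`, the partially labelled homomorphism densities `t_𝐱(H,·)` of pairwise
non-isomorphic `k`-labelled multigraphs with `n` edges and no unlabelled isolated
vertices are linearly independent as functions on `W`.
(b) Consequently the coefficients of a `(k,𝐱)`-labelled power series with positive
radius of convergence are uniquely determined by the function it defines on `W`. -/
theorem stmt18 (k : ℕ) (x : Fin k → ℝ) (hx01 : ∀ a, x a ∈ Set.Icc (0:ℝ) 1)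
    (hxdist : Function.Injective x) :
    (∀ (n m : ℕ) (H : Fin m → LMG k), (∀ i, (H i).G.ne = n) →
      (∀ i, (H i).NoUnlabIsolated) →
      (∀ i j, i ≠ j → ¬ LMGIso (H i) (H j)) →
      ∀ c : Fin m → ℝ,
        (∀ f ∈ Graphons, ∑ i, c i * lhom (H i) x f = 0) → ∀ i, c i = 0) ∧
    (∀ (R : Set (LMG k)), IsLRepSet k R → ∀ a a' : LMG k → ℝ,
      (∃ C M : ℝ, 0 ≤ C ∧ 0 ≤ M ∧
        ∀ n : ℕ, (∑ᶠ H ∈ {H ∈ R | H.G.ne = n}, |a H|) ≤ C * M ^ n) →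
      (∃ C M : ℝ, 0 ≤ C ∧ 0 ≤ M ∧
        ∀ n : ℕ, (∑ᶠ H ∈ {H ∈ R | H.G.ne = n}, |a' H|) ≤ C * M ^ n) →
      (∀ f ∈ Graphons,
        (∑' n : ℕ, ∑ᶠ H ∈ {H ∈ R | H.G.ne = n}, a H * lhom H x f)
          = ∑' n : ℕ, ∑ᶠ H ∈ {H ∈ R | H.G.ne = n}, a' H * lhom H x f) →
      ∀ H ∈ R, a H = a' H) := by
  refine ⟨?_, ?_⟩
  · intro n m H _ hI hiso c h i
    exact partA x hxdist Finset.univ H (fun i _ => hI i) (fun i _ j _ => hiso i j) c h i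
      (Finset.mem_univ i)
  · rintro R ⟨hR1, hR2⟩ a a' ⟨C, M, hC, hM, hCM⟩ ⟨C', M', hC', hM', hCM'⟩ hF H₀ hH₀
    have hfin : ∀ n, {H ∈ R | H.G.ne = n}.Finite := fun n =>
      (finite_lmg k n (k + 2 * n)).subset (by
        rintro H ⟨hH, rfl⟩
        exact ⟨rfl, nv_le H (hR1 H hH)⟩)
    let S : ℕ → Finset (LMG k) := fun n => (hfin n).toFinset
    have hS : ∀ n H, H ∈ S n ↔ H ∈ R ∧ H.G.ne = n := fun n H => by simp [S]
    have hsum : ∀ (n : ℕ) (g : LMG k → ℝ),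
        (∑ᶠ H ∈ {H ∈ R | H.G.ne = n}, g H) = ∑ H ∈ S n, g H := fun n g =>
      finsum_mem_eq_finite_toFinset_sum g (hfin n)
    simp only [hsum] at hCM hCM' hF
    have hbd : ∀ (a : LMG k → ℝ) (f : Kern), f ∈ Graphons → ∀ n,
        |∑ H ∈ S n, a H * lhom H x f| ≤ ∑ H ∈ S n, |a H| := by
      intro a f hf n
      refine (Finset.abs_sum_le_sum_abs _ _).trans (Finset.sum_le_sum fun H _ => ?_)
      rw [abs_mul]
      exact mul_le_of_le_one_right (abs_nonneg _) (lhom_abs_le H x f hf)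
    have hscale : ∀ (a : LMG k → ℝ) (f : Kern) (ε : ℝ) (n : ℕ),
        ∑ H ∈ S n, a H * lhom H x (ε • f) = ε ^ n * ∑ H ∈ S n, a H * lhom H x f := by
      intro a f ε n
      rw [Finset.mul_sum]
      refine Finset.sum_congr rfl fun H hH => ?_
      rw [lhom_smul, ((hS n H).1 hH).2]
      ring
    have hsm : ∀ (a : LMG k → ℝ) (C M : ℝ), 0 ≤ M → (∀ n, ∑ H ∈ S n, |a H| ≤ C * M ^ n) →
        ∀ f ∈ Graphons, ∀ ε : ℝ, 0 ≤ ε → ε * M < 1 →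
        Summable fun n => ε ^ n * ∑ H ∈ S n, a H * lhom H x f := by
      intro a C M hM hCM f hf ε hε hεM
      refine Summable.of_norm_bounded (g := fun n => C * (ε * M) ^ n) ?_ ?_
      · exact (summable_geometric_of_lt_one (by positivity) hεM).mul_left C
      · intro n
        rw [Real.norm_eq_abs, abs_mul, abs_pow, abs_of_nonneg hε, mul_pow]
        have := mul_le_mul_of_nonneg_left ((hbd a f hf n).trans (hCM n)) (pow_nonneg hε n)
        linarith
    have hcoef : ∀ f ∈ Graphons, ∀ n,
        ∑ H ∈ S n, a H * lhom H x f - ∑ H ∈ S n, a' H * lhom H x f = 0 := by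
      intro f hf
      refine coeff_zero_of_series _ (C + C') (M + M') (by positivity) ?_ ?_
      · intro n
        have h1 := (hbd a f hf n).trans (hCM n)
        have h2 := (hbd a' f hf n).trans (hCM' n)
        have h3 : M ^ n ≤ (M + M') ^ n := pow_le_pow_left₀ hM (by linarith) n
        have h4 : M' ^ n ≤ (M + M') ^ n := pow_le_pow_left₀ hM' (by linarith) n
        have h5 := mul_le_mul_of_nonneg_left h3 hC
        have h6 := mul_le_mul_of_nonneg_left h4 hC'
        refine (abs_sub _ _).trans ?_
        linarith
      · intro ε hε hε1
        have e1 : ε ≤ 1 := by nlinarith [mul_nonneg hε hM, mul_nonneg hε hM']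
        have e2 : ε * M < 1 := by nlinarith [mul_nonneg hε hM, mul_nonneg hε hM']
        have e3 : ε * M' < 1 := by nlinarith [mul_nonneg hε hM, mul_nonneg hε hM']
        simp only [mul_sub]
        rw [(hsm a C M hM hCM f hf ε hε e2).tsum_sub (hsm a' C' M' hM' hCM' f hf ε hε e3)]
        have := hF _ (smul_graphon_s18 hf hε e1)
        simp only [hscale] at this
        rw [this, sub_self]
    have := partA x hxdist (S H₀.G.ne) id (fun H hH => hR1 H ((hS _ H).1 hH).1)
      (fun H hH H' hH' hne hiso => hne ((hR2 H (hR1 H ((hS _ H).1 hH).1)).unique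
        ⟨((hS _ H).1 hH).1, lmgIso_refl H⟩ ⟨((hS _ H').1 hH').1, hiso⟩))
      (fun H => a H - a' H)
      (fun f hf => by
        rw [← hcoef f hf H₀.G.ne, ← Finset.sum_sub_distrib]
        exact Finset.sum_congr rfl fun H _ => by simp only [id]; ring)
      H₀ ((hS _ _).2 ⟨hH₀, rfl⟩)
    linarith
end

section
/- Let F(−) = Σ_{n≥0} Σ_{H∈ℋ_{n,k}} t_𝐱(H,−,g_H) be a weighted (k,𝐱)-labelled power series with radius of convergence R_F, where R_F^{-1} = limsup_{n→∞} (Σ_{H∈ℋ_{n,k}} ‖g_H‖_{1,𝐱})^{1/n}. Then: (a) F converges absolutely at every f ∈ 𝒲 with ‖f‖_∞ < R_F, i.e. Σ_{n≥0} Σ_{H∈ℋ_{n,k}} t_𝐱(H,|f|,|g_H|) < ∞; (b) for every 0 ≤ s < R_F the convergence of the series is uniform on the set 𝒲_{[-s,s]} of bounded symmetric measurable functions with values in [−s,s]; and (c) for every r with R_F < r < ∞ there exists f ∈ 𝒲 with ‖f‖_∞ < r at which F is not absolutely convergent. -/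
open MeasureTheory Filter Set Topology
open scoped BigOperators Classical ENNReal

section Aux19

lemma aux_finite (k n : ℕ) (R : Set (LMG k)) (hR : ∀ H ∈ R, H.NoUnlabIsolated) :
    {H ∈ R | H.G.ne = n}.Finite := by
  have h1 : ∀ m : ℕ, {H : LMG k | H.G.ne = n ∧ H.G.nv = m}.Finite := by
    intro m
    let T := {p : (Fin n → Fin m) × (Fin n → Fin m) × (Fin k → Fin m) //
      (∀ e, p.1 e ≠ p.2.1 e) ∧ Function.Injective p.2.2}
    let F : T → LMG k := fun p => ⟨⟨m, n, p.1.1, p.1.2.1, p.2.1⟩, p.1.2.2, p.2.2⟩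
    refine (Set.finite_range F).subset ?_
    rintro ⟨⟨nv, ne, s, t, hl⟩, lab, inj⟩ ⟨h1, h2⟩
    simp only at h1 h2
    subst h1; subst h2
    exact ⟨⟨(s, t, lab), hl, inj⟩, rfl⟩
  have h2 : (⋃ m ∈ Set.Iic (n + n + k), {H : LMG k | H.G.ne = n ∧ H.G.nv = m}).Finite :=
    (Set.finite_Iic _).biUnion fun m _ => h1 m
  refine h2.subset ?_
  rintro H ⟨hH, hn⟩
  simp only [Set.mem_iUnion, Set.mem_Iic, Set.mem_ofPred_eq, exists_prop]
  refine ⟨H.G.nv, ?_, hn, rfl⟩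
  have hs : Function.Surjective
      (Sum.elim (Sum.elim H.G.s H.G.t) H.lab : (Fin H.G.ne ⊕ Fin H.G.ne) ⊕ Fin k → Fin H.G.nv) := by
    intro v
    rcases hR H hH v with ⟨e, he | he⟩ | ⟨a, ha⟩
    · exact ⟨Sum.inl (Sum.inl e), he⟩
    · exact ⟨Sum.inl (Sum.inr e), he⟩
    · exact ⟨Sum.inr a, ha⟩
  have := Fintype.card_le_of_surjective _ hs
  simpa [hn] using this

lemma aux_assign_meas {k : ℕ} (H : LMG k) (x : Fin k → ℝ) : Measurable (H.assign x) := by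
  refine measurable_pi_lambda _ fun v => ?_
  unfold LMG.assign
  by_cases h : ∃ a, H.lab a = v
  · simp only [h, dite_true]; exact measurable_const
  · simp only [h, dite_false]; exact measurable_pi_apply v

lemma aux_integrable {k : ℕ} (H : LMG k) (x : Fin k → ℝ) (w : (Fin H.G.nv → ℝ) → ℝ)
    (hm : Measurable w) (hb : ∃ C : ℝ, ∀ y, |w y| ≤ C) :
    Integrable (fun y => |w (H.assign x y)|) (Measure.pi fun _ : Fin H.G.nv => μ01) := by
  obtain ⟨C, hC⟩ := hb
  refine Integrable.of_bound (C := C)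
    ((hm.comp (aux_assign_meas H x)).abs).aestronglyMeasurable (ae_of_all _ fun y => ?_)
  simpa using hC _

lemma aux_bound {k : ℕ} (H : LMG k) (x : Fin k → ℝ) (w : (Fin H.G.nv → ℝ) → ℝ)
    (hm : Measurable w) (hb : ∃ C : ℝ, ∀ y, |w y| ≤ C) (f : Kern) (s : ℝ)
    (hf : ∀ u v, |f u v| ≤ s) : |wlhom H x f w| ≤ s ^ H.G.ne * wnorm H x w := by
  unfold wlhom wnorm
  rw [← integral_const_mul, ← Real.norm_eq_abs]
  refine norm_integral_le_of_norm_le ((aux_integrable H x w hm hb).const_mul _)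
    (ae_of_all _ fun y => ?_)
  rw [norm_mul, norm_prod, mul_comm, Real.norm_eq_abs]
  refine mul_le_mul_of_nonneg_right ?_ (abs_nonneg _)
  calc _ ≤ ∏ _e : Fin H.G.ne, s :=
        Finset.prod_le_prod (fun _ _ => norm_nonneg _) fun e _ => hf _ _
    _ = _ := by simp

lemma aux_sum_bound {k : ℕ} (S : Set (LMG k)) (hS : S.Finite) (a b : LMG k → ℝ)
    (hab : ∀ H ∈ S, |a H| ≤ b H) : |∑ᶠ H ∈ S, a H| ≤ ∑ᶠ H ∈ S, b H := by
  rw [finsum_mem_eq_finite_toFinset_sum _ hS, finsum_mem_eq_finite_toFinset_sum _ hS]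
  exact (Finset.abs_sum_le_sum_abs _ _).trans
    (Finset.sum_le_sum fun H hH => hab H (hS.mem_toFinset.1 hH))

lemma aux_summable (c : ℕ → ℝ) (hc : ∀ n, 0 ≤ c n) (s : ℝ) (hs : 0 ≤ s)
    (h : ENNReal.ofReal s < (Filter.limsup (fun n : ℕ =>
        (ENNReal.ofReal (c n)) ^ ((1 : ℝ) / (n : ℝ))) atTop)⁻¹) :
    Summable (fun n => s ^ n * c n) := by
  obtain ⟨t, hst, htL⟩ := ENNReal.lt_iff_exists_nnreal_btwn.1 h
  have hst' : s < t := by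
    rw [← ENNReal.ofReal_coe_nnreal] at hst
    exact (ENNReal.ofReal_lt_ofReal_iff_of_nonneg hs).1 hst
  have ht : 0 < (t : ℝ) := hs.trans_lt hst'
  have hL := ENNReal.lt_inv_iff_lt_inv.1 htL
  have hev := Filter.eventually_lt_of_limsup_lt hL
  have hgeo : Summable (fun n : ℕ => (s / t) ^ n) :=
    summable_geometric_of_lt_one (by positivity) ((div_lt_one ht).2 hst')
  refine Summable.of_norm_bounded_eventually_nat hgeo ?_
  filter_upwards [hev, eventually_ge_atTop 1] with n hn hn1
  have hn0 : (n : ℝ) ≠ 0 := by positivity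
  have h1 : ENNReal.ofReal (c n) ≤ (t : ℝ≥0∞)⁻¹ ^ n := by
    have := pow_le_pow_left' hn.le n
    rwa [← ENNReal.rpow_natCast, ← ENNReal.rpow_mul, one_div, inv_mul_cancel₀ hn0,
      ENNReal.rpow_one] at this
  have h2 : c n ≤ ((t : ℝ)⁻¹) ^ n := by
    have h3 : ((t : ℝ≥0∞)⁻¹) ^ n = ENNReal.ofReal (((t : ℝ)⁻¹) ^ n) := by
      rw [ENNReal.ofReal_pow (by positivity), ENNReal.ofReal_inv_of_pos ht,
        ENNReal.ofReal_coe_nnreal]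
    rw [h3] at h1
    exact (ENNReal.ofReal_le_ofReal_iff (by positivity)).1 h1
  rw [Real.norm_eq_abs, abs_of_nonneg (mul_nonneg (pow_nonneg hs n) (hc n)), div_eq_mul_inv,
    mul_pow]
  exact mul_le_mul_of_nonneg_left h2 (pow_nonneg hs n)

lemma aux_not_summable (c : ℕ → ℝ) (r : ℝ)
    (h : (Filter.limsup (fun n : ℕ =>
        (ENNReal.ofReal (c n)) ^ ((1 : ℝ) / (n : ℝ))) atTop)⁻¹ < ENNReal.ofReal r) :
    ∃ s : ℝ, 0 < s ∧ s < r ∧ ¬ Summable (fun n => s ^ n * c n) := by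
  obtain ⟨s, hLs, hsr⟩ := ENNReal.lt_iff_exists_nnreal_btwn.1 h
  have hs : 0 < (s : ℝ) := by
    have : (0 : ℝ≥0∞) < s := (zero_le).trans_lt hLs
    exact_mod_cast this
  have hsr' : (s : ℝ) < r := by
    rw [← ENNReal.ofReal_coe_nnreal] at hsr
    exact (ENNReal.ofReal_lt_ofReal_iff_of_nonneg hs.le).1 hsr
  refine ⟨s, hs, hsr', fun hsum => ?_⟩
  have hL := ENNReal.inv_lt_iff_inv_lt.1 hLs
  have hfr := Filter.frequently_lt_of_lt_limsup (by isBoundedDefault) hL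
  have hlt : ∀ᶠ n in atTop, (s : ℝ) ^ n * c n < 1 :=
    hsum.tendsto_atTop_zero.eventually_lt_const one_pos
  obtain ⟨n, hn, hn2, hn1⟩ := (hfr.and_eventually (hlt.and (eventually_ge_atTop 1))).exists
  have hn0 : (n : ℝ) ≠ 0 := by positivity
  have h1 : (s : ℝ≥0∞)⁻¹ ^ n ≤ ENNReal.ofReal (c n) := by
    have := pow_le_pow_left' hn.le n
    rwa [← ENNReal.rpow_natCast (_ ^ _), ← ENNReal.rpow_mul, one_div, inv_mul_cancel₀ hn0,
      ENNReal.rpow_one] at this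
  have h3 : ((s : ℝ≥0∞)⁻¹) ^ n = ENNReal.ofReal (((s : ℝ)⁻¹) ^ n) := by
    rw [ENNReal.ofReal_pow (by positivity), ENNReal.ofReal_inv_of_pos hs,
      ENNReal.ofReal_coe_nnreal]
  rw [h3] at h1
  have hp : 0 < ((s : ℝ)⁻¹) ^ n := by positivity
  have h2 : ((s : ℝ)⁻¹) ^ n ≤ c n := by
    by_contra hcon
    exact absurd h1 (not_le.2 ((ENNReal.ofReal_lt_ofReal_iff hp).2 (not_le.1 hcon)))
  have : (1 : ℝ) ≤ (s : ℝ) ^ n * c n := by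
    calc (1 : ℝ) = (s : ℝ) ^ n * ((s : ℝ)⁻¹) ^ n := by
          rw [← mul_pow, mul_inv_cancel₀ hs.ne', one_pow]
      _ ≤ _ := mul_le_mul_of_nonneg_left h2 (by positivity)
  linarith

end Aux19

/-- Let `F(·) = Σ_n Σ_{H ∈ ℋ_{n,k}} t_𝐱(H, ·, g_H)` be a weighted
`(k,𝐱)`-labelled power series with radius of convergence `R_F` (where
`R_F⁻¹ = limsup_n (Σ_{H ∈ ℋ_{n,k}} ‖g_H‖_{1,𝐱})^{1/n}`).  Then (a) `F` converges
absolutely at every kernel `f` with `‖f‖_∞ < R_F`; (b) the convergence is uniform on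
`𝒲_{[-s,s]}` for every `0 ≤ s < R_F`; and (c) for every finite `r > R_F` there is a
kernel `f` with `‖f‖_∞ < r` at which `F` is not absolutely convergent. -/
theorem stmt19 (k : ℕ) (x : Fin k → ℝ) (hx01 : ∀ a, x a ∈ Set.Icc (0:ℝ) 1)
    (R : Set (LMG k)) (hR : IsLRepSet k R)
    (w : (H : LMG k) → (Fin H.G.nv → ℝ) → ℝ)
    (hwm : ∀ H : LMG k, Measurable (w H))
    (hwb : ∀ H : LMG k, ∃ C : ℝ, ∀ y, |w H y| ≤ C)
    (RF : ℝ≥0∞)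
    (hRF : RF = (Filter.limsup (fun n : ℕ =>
        (ENNReal.ofReal (∑ᶠ H ∈ {H ∈ R | H.G.ne = n}, wnorm H x (w H)))
          ^ ((1 : ℝ) / (n : ℝ))) atTop)⁻¹) :
    (∀ f : Kern, IsKernel f →
      (∃ s : ℝ, 0 ≤ s ∧ ENNReal.ofReal s < RF ∧ ∀ u v, |f u v| ≤ s) →
      Summable (fun n : ℕ => ∑ᶠ H ∈ {H ∈ R | H.G.ne = n},
        wlhom H x (fun u v => |f u v|) (fun y => |w H y|))) ∧
    (∀ s : ℝ, 0 ≤ s → ENNReal.ofReal s < RF →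
      TendstoUniformlyOn
        (fun N (f : Kern) => ∑ n ∈ Finset.range (N + 1),
          ∑ᶠ H ∈ {H ∈ R | H.G.ne = n}, wlhom H x f (w H))
        (fun f => ∑' n : ℕ, ∑ᶠ H ∈ {H ∈ R | H.G.ne = n}, wlhom H x f (w H))
        atTop
        {f : Kern | IsKernel f ∧ ∀ u v : ℝ, f u v ∈ Set.Icc (-s) s}) ∧
    (∀ r : ℝ, RF < ENNReal.ofReal r →
      ∃ f : Kern, IsKernel f ∧ (∃ s : ℝ, 0 ≤ s ∧ s < r ∧ ∀ u v, |f u v| ≤ s) ∧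
        ¬ Summable (fun n : ℕ => ∑ᶠ H ∈ {H ∈ R | H.G.ne = n},
            wlhom H x (fun u v => |f u v|) (fun y => |w H y|))) := by
  subst hRF
  have hfin : ∀ n, {H ∈ R | H.G.ne = n}.Finite := fun n => aux_finite k n R hR.1
  have hc : ∀ n, 0 ≤ ∑ᶠ H ∈ {H ∈ R | H.G.ne = n}, wnorm H x (w H) := fun n =>
    finsum_nonneg fun H => finsum_nonneg fun _ => integral_nonneg fun _ => abs_nonneg _
  have hmul : ∀ (s : ℝ) (n : ℕ), ∑ᶠ H ∈ {H ∈ R | H.G.ne = n}, s ^ H.G.ne * wnorm H x (w H)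
      = s ^ n * ∑ᶠ H ∈ {H ∈ R | H.G.ne = n}, wnorm H x (w H) := by
    intro s n
    rw [mul_finsum_mem]
    exact finsum_mem_congr rfl fun H hH => by rw [hH.2]
  refine ⟨?_, ?_, ?_⟩
  · rintro f - ⟨s, hs, hsR, hfs⟩
    refine Summable.of_norm_bounded (aux_summable _ hc s hs hsR) fun n => ?_
    rw [Real.norm_eq_abs, ← hmul]
    refine aux_sum_bound _ (hfin n) _ _ fun H _ => ?_
    have := aux_bound H x (fun y => |w H y|) (hwm H).abs (by simpa using hwb H)
      (fun u v => |f u v|) s (by simpa using hfs)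
    simpa [wnorm] using this
  · intro s hs hsR
    have key := tendstoUniformlyOn_tsum_nat
      (f := fun n (f : Kern) => ∑ᶠ H ∈ {H ∈ R | H.G.ne = n}, wlhom H x f (w H))
      (s := {f : Kern | IsKernel f ∧ ∀ u v : ℝ, f u v ∈ Set.Icc (-s) s})
      (aux_summable _ hc s hs hsR) (by
        rintro n f ⟨-, hf⟩
        rw [Real.norm_eq_abs, ← hmul]
        exact aux_sum_bound _ (hfin n) _ _ fun H _ =>
          aux_bound H x (w H) (hwm H) (hwb H) f s fun u v => abs_le.2 (hf u v))
    intro U hU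
    exact (tendsto_add_atTop_nat 1).eventually (key U hU)
  · intro r hr
    obtain ⟨s, hs, hsr, hns⟩ := aux_not_summable _ r hr
    refine ⟨fun _ _ => s, ⟨⟨measurable_const, fun _ _ => rfl⟩, s, fun _ _ => (abs_of_pos hs).le⟩,
      ⟨s, hs.le, hsr, fun _ _ => (abs_of_pos hs).le⟩, fun hsum => hns ?_⟩
    convert hsum using 2 with n
    rw [← hmul]
    refine finsum_mem_congr rfl fun H _ => ?_
    simp only [wlhom, wnorm, abs_of_pos hs, Finset.prod_const, Finset.card_univ, Fintype.card_fin]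
    rw [integral_mul_const, mul_comm]
end
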